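/- arXiv:1509.07883 — 3 statements merged into one kernel-verified Lean document; each statement's English description precedes it below -/
import Mathlib

section
/- Let A be an n×n quaternion matrix that is Hermitian, i.e. A* = A, where A* denotes the conjugate transpose. Then all n row determinants and all n column determinants of A coincide: rdet_1 A = ⋯ = rdet_n A = cdet_1 A = ⋯ = cdet_n A, and their common value is a real number (lies in the real subfield ℝ ⊆ ℍ). -/
open Matrix
open scoped Classical

noncomputable section

local notation "ℍ" => Quaternion ℝ

/-- The product of the entries of `A` along the `σ`-cycle of `j`, taken in forward
order starting at `j`:  `a_{j, σj} · a_{σj, σ²j} ⋯ a_{σ^{l-1}j, j}`. -/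
def cycProd {n : ℕ} (A : Matrix (Fin n) (Fin n) ℍ) (σ : Equiv.Perm (Fin n)) (j : Fin n) : ℍ :=
  ((List.range (Function.minimalPeriod (⇑σ) j)).map
    fun t => A ((σ ^ t) j) ((σ ^ (t + 1)) j)).prod

/-- The minimal elements (leaders) of the `σ`-cycles not containing `i`, in
increasing order. -/
def othersList {n : ℕ} (σ : Equiv.Perm (Fin n)) (i : Fin n) : List (Fin n) :=
  (Finset.univ.filter fun j =>
    ¬ σ.SameCycle i j ∧ ∀ t, σ.SameCycle j t → j ≤ t).sort (· ≤ ·)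

/-- The `i`-th row determinant of a square quaternion matrix: the cycle containing
`i` is written first, starting at `i`; the remaining cycles follow, each starting at
its minimal element, ordered by increasing minimal elements; the sign `(-1)^{n-r}`
is the sign of the permutation. -/
def rdet {n : ℕ} (A : Matrix (Fin n) (Fin n) ℍ) (i : Fin n) : ℍ :=
  ∑ σ : Equiv.Perm (Fin n), ((Equiv.Perm.sign σ : ℤ) •
    (cycProd A σ i * ((othersList σ i).map (cycProd A σ)).prod))

/-- The `j`-th column determinant of a square quaternion matrix (mirror convention:
the cycle containing `j` is written last, ending at `j`; the remaining cycles
precede it, ordered by decreasing minimal elements). -/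
def cdet {n : ℕ} (A : Matrix (Fin n) (Fin n) ℍ) (j : Fin n) : ℍ :=
  ∑ σ : Equiv.Perm (Fin n), ((Equiv.Perm.sign σ : ℤ) •
    ((((othersList σ j).reverse.map (cycProd A σ)).prod) * cycProd A σ j))

/-- The determinant of a (Hermitian) quaternion matrix: all cycles ordered by
increasing minimal elements, each starting at its minimal element.  For Hermitian
matrices this is the common value of all row and column determinants. -/
def qdet {n : ℕ} (A : Matrix (Fin n) (Fin n) ℍ) : ℍ :=
  ∑ σ : Equiv.Perm (Fin n), ((Equiv.Perm.sign σ : ℤ) •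
    (((Finset.univ.filter fun j => ∀ t, σ.SameCycle j t → j ≤ t).sort (· ≤ ·)).map
      (cycProd A σ)).prod)

/-- The principal submatrix of `A` with rows and columns indexed by `β`. -/
def pSub {n : ℕ} (A : Matrix (Fin n) (Fin n) ℍ) (β : Finset (Fin n)) :
    Matrix (Fin β.card) (Fin β.card) ℍ :=
  fun a b => A ((β.orderIsoOfFin rfl) a) ((β.orderIsoOfFin rfl) b)

/-- `|A^β_β|`, the determinant of the principal submatrix indexed by `β`. -/
def minorDet {n : ℕ} (A : Matrix (Fin n) (Fin n) ℍ) (β : Finset (Fin n)) : ℍ :=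
  qdet (pSub A β)

/-- `cdet_i ((A)^β_β)` for `i ∈ β`. -/
def minorCdet {n : ℕ} (A : Matrix (Fin n) (Fin n) ℍ) (β : Finset (Fin n)) (i : Fin n) : ℍ :=
  if h : i ∈ β then cdet (pSub A β) ((β.orderIsoOfFin rfl).symm ⟨i, h⟩) else 0

/-- `rdet_j ((A)^α_α)` for `j ∈ α`. -/
def minorRdet {n : ℕ} (A : Matrix (Fin n) (Fin n) ℍ) (α : Finset (Fin n)) (j : Fin n) : ℍ :=
  if h : j ∈ α then rdet (pSub A α) ((α.orderIsoOfFin rfl).symm ⟨j, h⟩) else 0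

/-- The rank of a quaternion matrix: the dimension of its (left) row space. -/
def qrank {m n : ℕ} (A : Matrix (Fin m) (Fin n) ℍ) : ℕ :=
  Module.finrank ℍ (Submodule.span ℍ (Set.range A))

/-- `Ind A`: the smallest `k` with `rank A^{k+1} = rank A^k`. -/
def qindex {n : ℕ} (A : Matrix (Fin n) (Fin n) ℍ) : ℕ :=
  sInf {k | qrank (A ^ (k + 1)) = qrank (A ^ k)}

/-- `X` is the Moore–Penrose inverse of `A`. -/
def IsMP {m n : ℕ} (A : Matrix (Fin m) (Fin n) ℍ) (X : Matrix (Fin n) (Fin m) ℍ) : Prop :=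
  A * X * A = A ∧ X * A * X = X ∧ (A * X)ᴴ = A * X ∧ (X * A)ᴴ = X * A

/-- `X` is the Drazin inverse of `A`. -/
def IsDrazin {n : ℕ} (A X : Matrix (Fin n) (Fin n) ℍ) : Prop :=
  X * A * X = X ∧ A * X = X * A ∧ A ^ (qindex A + 1) * X = A ^ qindex A

/-- `X` is the W-weighted Drazin inverse of `A` with respect to `W`. -/
def IsWDrazin {m n : ℕ} (A : Matrix (Fin m) (Fin n) ℍ) (W : Matrix (Fin n) (Fin m) ℍ)
    (X : Matrix (Fin m) (Fin n) ℍ) : Prop :=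
  (A * W) ^ (max (qindex (A * W)) (qindex (W * A)) + 1) * X * W
      = (A * W) ^ max (qindex (A * W)) (qindex (W * A)) ∧
  X * W * A * W * X = X ∧ A * W * X = X * W * A

theorem star_list_prod {R : Type*} [Monoid R] [StarMul R] (L : List R) :
    star L.prod = (L.map star).reverse.prod := by
  induction L with
  | nil => simp
  | cons a L ih => simp [ih]

theorem conj_cycProd {n : ℕ} {A : Matrix (Fin n) (Fin n) ℍ} (hA : Aᴴ = A)
    (σ : Equiv.Perm (Fin n)) (j : Fin n) : cycProd A σ⁻¹ j = star (cycProd A σ j) := by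
  have hstar : ∀ a b, star (A a b) = A b a := fun a b => by
    conv_rhs => rw [← hA]
    rfl
  have hperiod : Function.minimalPeriod (⇑σ⁻¹) j = Function.minimalPeriod (⇑σ) j := by
    rw [Function.minimalPeriod_eq_minimalPeriod_iff]
    intro k
    simp only [Function.IsPeriodicPt, Function.IsFixedPt, ← Equiv.Perm.coe_pow]
    rw [inv_pow, Equiv.Perm.inv_eq_iff_eq, eq_comm]
  have hfix : (σ ^ Function.minimalPeriod (⇑σ) j) j = j := by
    rw [Equiv.Perm.coe_pow]
    exact Function.isPeriodicPt_minimalPeriod (⇑σ) j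
  have hinv : ∀ t ≤ Function.minimalPeriod (⇑σ) j,
      (σ⁻¹ ^ t) j = (σ ^ (Function.minimalPeriod (⇑σ) j - t)) j := by
    intro t ht
    rw [inv_pow, Equiv.Perm.inv_eq_iff_eq, ← Equiv.Perm.mul_apply, ← pow_add,
      Nat.add_sub_cancel' ht, hfix]
  unfold cycProd
  rw [hperiod, star_list_prod]
  congr 1
  refine List.ext_getElem (by simp) fun t h₁ h₂ => ?_
  have ht : t < Function.minimalPeriod (⇑σ) j := by simpa using h₁
  simp only [List.getElem_map, List.getElem_range, List.getElem_reverse, List.length_map,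
    List.length_range, hstar]
  rw [hinv t ht.le, hinv (t + 1) ht]
  congr 3 <;> omega

theorem cycProd_congr {n : ℕ} (A : Matrix (Fin n) (Fin n) ℍ) {σ τ : Equiv.Perm (Fin n)}
    {j : Fin n} (h : ∀ t : ℕ, (σ ^ t) j = (τ ^ t) j) : cycProd A σ j = cycProd A τ j := by
  have hperiod : Function.minimalPeriod (⇑σ) j = Function.minimalPeriod (⇑τ) j := by
    rw [Function.minimalPeriod_eq_minimalPeriod_iff]
    intro k
    simp only [Function.IsPeriodicPt, Function.IsFixedPt, ← Equiv.Perm.coe_pow, h]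
  simp only [cycProd, hperiod, h]

theorem Quaternion.re_mul_comm (a b : ℍ) : (a * b).re = (b * a).re := by
  simp only [Quaternion.re_mul]
  ring

theorem re_cycProd_apply {n : ℕ} (A : Matrix (Fin n) (Fin n) ℍ) (σ : Equiv.Perm (Fin n))
    (j : Fin n) : (cycProd A σ (σ j)).re = (cycProd A σ j).re := by
  have hper : j ∈ Function.periodicPts (⇑σ) :=
    Function.Injective.mem_periodicPts σ.injective j
  have hpos := Function.minimalPeriod_pos_of_mem_periodicPts hper
  have hfix : (σ ^ Function.minimalPeriod (⇑σ) j) j = j := by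
    rw [Equiv.Perm.coe_pow]
    exact Function.isPeriodicPt_minimalPeriod (⇑σ) j
  have hshift : ∀ t : ℕ, (σ ^ t) (σ j) = (σ ^ (t + 1)) j := fun t => by
    rw [pow_succ, Equiv.Perm.mul_apply]
  unfold cycProd
  rw [Function.minimalPeriod_apply hper]
  simp only [hshift]
  obtain ⟨p, hp⟩ := Nat.exists_eq_succ_of_ne_zero hpos.ne'
  rw [hp] at hfix ⊢
  conv_lhs => rw [List.range_succ]
  conv_rhs => rw [List.range_succ_eq_map]
  simp only [List.map_append, List.map_cons, List.map_nil, List.prod_append, List.prod_cons,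
    List.prod_nil, mul_one, List.map_map]
  rw [Quaternion.re_mul_comm]
  have hlast : (σ ^ (p + 1 + 1)) j = (σ ^ (0 + 1)) j := by
    rw [pow_succ', Equiv.Perm.mul_apply, hfix, zero_add, pow_one]
  rw [hlast, hfix]
  rfl

theorem re_cycProd_eq_of_sameCycle {n : ℕ} (A : Matrix (Fin n) (Fin n) ℍ)
    {σ : Equiv.Perm (Fin n)} {i j : Fin n} (h : σ.SameCycle i j) :
    (cycProd A σ i).re = (cycProd A σ j).re := by
  obtain ⟨k, rfl⟩ := h.exists_nat_pow_eq
  induction k with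
  | zero => rfl
  | succ k ih =>
    rw [pow_succ', Equiv.Perm.mul_apply, re_cycProd_apply]
    exact ih ⟨k, rfl⟩

/-- The permutation obtained from `σ` by reversing the cycle through `m`. -/
def reverseCycle {n : ℕ} (m : Fin n) (σ : Equiv.Perm (Fin n)) : Equiv.Perm (Fin n) :=
  σ * (σ.cycleOf m)⁻¹ * (σ.cycleOf m)⁻¹

section reverseCycle

variable {n : ℕ} {m : Fin n} {σ : Equiv.Perm (Fin n)} {x : Fin n}

theorem reverseCycle_apply_of_sameCycle (h : σ.SameCycle m x) :
    reverseCycle m σ x = σ⁻¹ x := by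
  have hinv : ∀ y, σ.SameCycle m y → (σ.cycleOf m)⁻¹ y = σ⁻¹ y := fun y hy => by
    rw [Equiv.Perm.cycleOf_inv, Equiv.Perm.cycleOf_apply, if_pos (Equiv.Perm.sameCycle_inv.2 hy)]
  simp only [reverseCycle, Equiv.Perm.mul_apply]
  rw [hinv x h, hinv (σ⁻¹ x) (Equiv.Perm.sameCycle_symm_apply_right.2 h)]
  exact σ.apply_symm_apply _

theorem reverseCycle_apply_of_not_sameCycle (h : ¬ σ.SameCycle m x) :
    reverseCycle m σ x = σ x := by
  have hinv : (σ.cycleOf m)⁻¹ x = x := by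
    rw [Equiv.Perm.cycleOf_inv, Equiv.Perm.cycleOf_apply,
      if_neg (fun h' => h (Equiv.Perm.sameCycle_inv.1 h'))]
  simp only [reverseCycle, Equiv.Perm.mul_apply, hinv]

theorem reverseCycle_pow_apply_of_sameCycle (h : σ.SameCycle m x) (t : ℕ) :
    (reverseCycle m σ ^ t) x = (σ⁻¹ ^ t) x := by
  induction t with
  | zero => rfl
  | succ t ih =>
    rw [pow_succ', Equiv.Perm.mul_apply, ih, reverseCycle_apply_of_sameCycle,
      pow_succ', Equiv.Perm.mul_apply]
    exact Equiv.Perm.sameCycle_inv.1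
      (Equiv.Perm.sameCycle_pow_right.2 (Equiv.Perm.sameCycle_inv.2 h))

theorem reverseCycle_pow_apply_of_not_sameCycle (h : ¬ σ.SameCycle m x) (t : ℕ) :
    (reverseCycle m σ ^ t) x = (σ ^ t) x := by
  induction t with
  | zero => rfl
  | succ t ih =>
    rw [pow_succ', Equiv.Perm.mul_apply, ih, reverseCycle_apply_of_not_sameCycle,
      pow_succ', Equiv.Perm.mul_apply]
    exact fun h' => h (Equiv.Perm.sameCycle_pow_right.1 h')

theorem sameCycle_reverseCycle {y : Fin n} :
    (reverseCycle m σ).SameCycle x y ↔ σ.SameCycle x y := by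
  by_cases h : σ.SameCycle m x
  · rw [← Equiv.Perm.sameCycle_inv (f := σ)]
    constructor <;> intro hxy <;> obtain ⟨k, rfl⟩ := hxy.exists_nat_pow_eq
    · exact ⟨k, by simpa using (reverseCycle_pow_apply_of_sameCycle h k).symm⟩
    · exact ⟨k, by simpa using reverseCycle_pow_apply_of_sameCycle h k⟩
  · constructor <;> intro hxy <;> obtain ⟨k, rfl⟩ := hxy.exists_nat_pow_eq
    · exact ⟨k, by simpa using (reverseCycle_pow_apply_of_not_sameCycle h k).symm⟩
    · exact ⟨k, by simpa using reverseCycle_pow_apply_of_not_sameCycle h k⟩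

theorem reverseCycle_involutive (m : Fin n) : Function.Involutive (reverseCycle m) := by
  intro σ
  ext1 x
  by_cases h : σ.SameCycle m x
  · rw [reverseCycle_apply_of_sameCycle (sameCycle_reverseCycle.2 h),
      Equiv.Perm.inv_eq_iff_eq,
      reverseCycle_apply_of_sameCycle (Equiv.Perm.sameCycle_apply_right.2 h)]
    exact (σ.symm_apply_apply x).symm
  · rw [reverseCycle_apply_of_not_sameCycle (mt sameCycle_reverseCycle.1 h),
      reverseCycle_apply_of_not_sameCycle h]

theorem sign_reverseCycle : Equiv.Perm.sign (reverseCycle m σ) = Equiv.Perm.sign σ := by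
  simp [reverseCycle, mul_assoc]

theorem othersList_reverseCycle (i : Fin n) :
    othersList (reverseCycle m σ) i = othersList σ i := by
  simp only [othersList, sameCycle_reverseCycle]

theorem cycProd_reverseCycle_of_sameCycle {A : Matrix (Fin n) (Fin n) ℍ} (hA : Aᴴ = A)
    (h : σ.SameCycle m x) : cycProd A (reverseCycle m σ) x = star (cycProd A σ x) := by
  rw [← conj_cycProd hA]
  exact cycProd_congr A (reverseCycle_pow_apply_of_sameCycle h)

theorem cycProd_reverseCycle_of_not_sameCycle (A : Matrix (Fin n) (Fin n) ℍ)
    (h : ¬ σ.SameCycle m x) : cycProd A (reverseCycle m σ) x = cycProd A σ x :=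
  cycProd_congr A (reverseCycle_pow_apply_of_not_sameCycle h)

end reverseCycle

theorem List.prod_map_add_prod_map {α R : Type*} [Semiring R] {L : List α} (hL : L.Nodup)
    {m : α} (hm : m ∈ L) {f g h k : α → R} (hf : ∀ j ∈ L, j ≠ m → f j = g j ∧ h j = g j ∧ k j = g j)
    (hadd : f m + g m = h m + k m) :
    (L.map f).prod + (L.map g).prod = (L.map h).prod + (L.map k).prod := by
  induction L with
  | nil => simp at hm
  | cons a L ih =>
    rw [List.nodup_cons] at hL
    simp only [List.map_cons, List.prod_cons]
    by_cases ha : a = m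
    · subst ha
      have hne : ∀ j ∈ L, j ≠ a := fun j hj hja => hL.1 (hja ▸ hj)
      have hfL : L.map f = L.map g := List.map_congr_left fun j hj =>
        (hf j (List.mem_cons_of_mem _ hj) (hne j hj)).1
      have hhL : L.map h = L.map g := List.map_congr_left fun j hj =>
        (hf j (List.mem_cons_of_mem _ hj) (hne j hj)).2.1
      have hkL : L.map k = L.map g := List.map_congr_left fun j hj =>
        (hf j (List.mem_cons_of_mem _ hj) (hne j hj)).2.2
      rw [hfL, hhL, hkL, ← add_mul, ← add_mul, hadd]
    · obtain ⟨h₁, h₂, h₃⟩ := hf a List.mem_cons_self ha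
      have hmL : m ∈ L := (List.mem_cons.1 hm).resolve_left (Ne.symm ha)
      rw [h₁, h₂, h₃, ← mul_add, ← mul_add,
        ih hL.2 hmL fun j hj => hf j (List.mem_cons_of_mem _ hj)]

/-- The cycle product of `A` along the `σ`-cycle of `j`, replaced by its real part when `j ∈ S`. -/
def partialRe {n : ℕ} (A : Matrix (Fin n) (Fin n) ℍ) (S : Finset (Fin n))
    (σ : Equiv.Perm (Fin n)) (j : Fin n) : ℍ :=
  if j ∈ S then ((cycProd A σ j).re : ℍ) else cycProd A σ j

theorem partialRe_reverseCycle_of_not_sameCycle {n : ℕ} (A : Matrix (Fin n) (Fin n) ℍ)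
    (S : Finset (Fin n)) {σ : Equiv.Perm (Fin n)} {m j : Fin n} (h : ¬ σ.SameCycle m j) :
    partialRe A S (reverseCycle m σ) j = partialRe A S σ j := by
  simp only [partialRe, cycProd_reverseCycle_of_not_sameCycle A h]

theorem partialRe_insert_of_ne {n : ℕ} (A : Matrix (Fin n) (Fin n) ℍ)
    (S : Finset (Fin n)) (σ : Equiv.Perm (Fin n)) {m j : Fin n} (h : j ≠ m) :
    partialRe A (insert m S) σ j = partialRe A S σ j := by
  simp [partialRe, h]

section representatives

variable {n : ℕ} {A : Matrix (Fin n) (Fin n) ℍ} {L : Equiv.Perm (Fin n) → List (Fin n)}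

theorem sum_sign_smul_prod_partialRe_insert (hA : Aᴴ = A)
    (hL : ∀ m σ, L (reverseCycle m σ) = L σ)
    (hpw : ∀ σ : Equiv.Perm (Fin n), (L σ).Pairwise fun a b => ¬ σ.SameCycle a b)
    {S : Finset (Fin n)} {m : Fin n} (hm : m ∉ S) :
    ∑ σ : Equiv.Perm (Fin n), (Equiv.Perm.sign σ : ℤ) •
        ((L σ).map (partialRe A (insert m S) σ)).prod =
      ∑ σ : Equiv.Perm (Fin n), (Equiv.Perm.sign σ : ℤ) •
        ((L σ).map (partialRe A S σ)).prod := by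
  have hsum : ∀ F : Equiv.Perm (Fin n) → ℍ, ∑ σ, F σ + ∑ σ, F σ =
      ∑ σ, (F σ + F (reverseCycle m σ)) := fun F => by
    rw [Finset.sum_add_distrib]
    congr 1
    exact (Equiv.sum_comp (reverseCycle_involutive m).toPerm F).symm
  have : IsAddTorsionFree ℍ := .of_module_rat ℍ
  refine nsmul_right_injective two_ne_zero ?_
  simp only [two_nsmul]
  rw [hsum, hsum]
  refine Finset.sum_congr rfl fun σ _ => ?_
  simp only [sign_reverseCycle, hL]
  rw [← smul_add, ← smul_add]
  congr 1
  by_cases hmem : m ∈ L σ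
  · have hnodup : (L σ).Nodup := by
      refine List.Pairwise.imp ?_ (hpw σ)
      rintro a b h rfl
      exact h (Equiv.Perm.SameCycle.refl σ a)
    have : Std.Symm fun a b => ¬ σ.SameCycle a b := ⟨fun _ _ h h' => h h'.symm⟩
    refine List.prod_map_add_prod_map hnodup hmem (fun j hj hjm => ?_) ?_
    · have hmj : ¬ σ.SameCycle m j :=
        (hpw σ).forall hmem hj hjm.symm
      simp only [partialRe_insert_of_ne A S _ hjm, partialRe_reverseCycle_of_not_sameCycle A _ hmj,
        and_self]
    · simp only [partialRe, Finset.mem_insert_self, if_true, if_neg hm,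
        cycProd_reverseCycle_of_sameCycle hA (Equiv.Perm.SameCycle.refl σ m),
        Quaternion.re_star, Quaternion.self_add_star]
      rw [two_mul]
  · have hne : ∀ j ∈ L σ, j ≠ m := fun j hj hjm => hmem (hjm ▸ hj)
    congr 2 <;> exact List.map_congr_left fun j hj => partialRe_insert_of_ne A S _ (hne j hj)

/-- Summed over all permutations, cycle products of a Hermitian matrix may be replaced by their
real parts, for any choice of representatives of cycles that ignores the orientation of cycles. -/
theorem sum_sign_smul_prod_cycProd (hA : Aᴴ = A) (hL : ∀ m σ, L (reverseCycle m σ) = L σ)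
    (hpw : ∀ σ : Equiv.Perm (Fin n), (L σ).Pairwise fun a b => ¬ σ.SameCycle a b) :
    ∑ σ : Equiv.Perm (Fin n), (Equiv.Perm.sign σ : ℤ) • ((L σ).map (cycProd A σ)).prod =
      ((∑ σ : Equiv.Perm (Fin n), (Equiv.Perm.sign σ : ℤ) •
        ((L σ).map fun j => (cycProd A σ j).re).prod : ℝ) : ℍ) := by
  have hS : ∀ S : Finset (Fin n),
      ∑ σ : Equiv.Perm (Fin n), (Equiv.Perm.sign σ : ℤ) •
        ((L σ).map (partialRe A S σ)).prod =
      ∑ σ : Equiv.Perm (Fin n), (Equiv.Perm.sign σ : ℤ) • ((L σ).map (cycProd A σ)).prod := by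
    intro S
    induction S using Finset.induction_on with
    | empty =>
      have hempty : ∀ σ, partialRe A ∅ σ = cycProd A σ := fun σ => by
        ext1 j
        simp [partialRe]
      simp only [hempty]
    | insert m S hm ih => rw [sum_sign_smul_prod_partialRe_insert hA hL hpw hm, ih]
  rw [← hS Finset.univ, ← Quaternion.algebraMap_def, map_sum]
  refine Finset.sum_congr rfl fun σ _ => ?_
  rw [map_zsmul, map_list_prod, List.map_map]
  congr 3
  ext1 j
  simp [partialRe, Quaternion.algebraMap_def]

end representatives

theorem pairwise_cons_othersList {n : ℕ} (σ : Equiv.Perm (Fin n)) (i : Fin n) :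
    (i :: othersList σ i).Pairwise fun a b => ¬ σ.SameCycle a b := by
  rw [List.pairwise_cons]
  refine ⟨fun j hj => ?_, ?_⟩
  · simp only [othersList, Finset.mem_sort, Finset.mem_filter] at hj
    exact hj.2.1
  · have hnodup : (othersList σ i).Nodup := Finset.sort_nodup _ _
    refine hnodup.pairwise_of_forall_ne fun a ha b hb hab h => hab ?_
    simp only [othersList, Finset.mem_sort, Finset.mem_filter] at ha hb
    exact le_antisymm (ha.2.2 b h) (hb.2.2 a h.symm)

theorem prod_cons_othersList {n : ℕ} {M : Type*} [CommMonoid M] {σ : Equiv.Perm (Fin n)}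
    {f : Fin n → M} (hf : ∀ a b, σ.SameCycle a b → f a = f b) (i : Fin n) :
    ((i :: othersList σ i).map f).prod =
      ∏ j with ∀ t, σ.SameCycle j t → j ≤ t, f j := by
  obtain ⟨m, hm, hmin⟩ := Finset.exists_min_image
    (Finset.univ.filter fun j => σ.SameCycle i j) id
    ⟨i, Finset.mem_filter.2 ⟨Finset.mem_univ _, Equiv.Perm.SameCycle.rfl⟩⟩
  simp only [Finset.mem_filter, Finset.mem_univ, true_and, id] at hm hmin
  have hset : (Finset.univ.filter fun j => ∀ t, σ.SameCycle j t → j ≤ t) =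
      insert m (othersList σ i).toFinset := by
    ext j
    simp only [othersList, Finset.sort_toFinset, Finset.mem_insert, Finset.mem_filter,
      Finset.mem_univ, true_and]
    constructor
    · intro hj
      by_cases hij : σ.SameCycle i j
      · exact Or.inl (le_antisymm (hj m (hij.symm.trans hm)) (hmin j hij))
      · exact Or.inr ⟨hij, hj⟩
    · rintro (rfl | hj)
      · exact fun t ht => hmin t (hm.trans ht)
      · exact hj.2
  have hnot : m ∉ (othersList σ i).toFinset := by
    simp [othersList, hm]
  rw [hset, Finset.prod_insert hnot, List.prod_toFinset f (l := othersList σ i) (Finset.sort_nodup _ _),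
    List.map_cons, List.prod_cons, hf i m hm]

/-- The common value of the row and column determinants of a Hermitian matrix. -/
def hermitianDet {n : ℕ} (A : Matrix (Fin n) (Fin n) ℍ) : ℝ :=
  ∑ σ : Equiv.Perm (Fin n), (Equiv.Perm.sign σ : ℤ) •
    ∏ j with ∀ t, σ.SameCycle j t → j ≤ t, (cycProd A σ j).re

theorem rdet_eq_hermitianDet {n : ℕ} {A : Matrix (Fin n) (Fin n) ℍ} (hA : Aᴴ = A) (i : Fin n) :
    rdet A i = (hermitianDet A : ℍ) := by
  have h := sum_sign_smul_prod_cycProd (L := fun σ => i :: othersList σ i) hA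
    (fun m σ => by rw [othersList_reverseCycle]) fun σ => pairwise_cons_othersList σ i
  simp only [prod_cons_othersList fun a b => re_cycProd_eq_of_sameCycle A] at h
  simpa only [rdet, hermitianDet, List.map_cons, List.prod_cons] using h

theorem cdet_eq_hermitianDet {n : ℕ} {A : Matrix (Fin n) (Fin n) ℍ} (hA : Aᴴ = A) (i : Fin n) :
    cdet A i = (hermitianDet A : ℍ) := by
  have h := sum_sign_smul_prod_cycProd (L := fun σ => (i :: othersList σ i).reverse) hA
    (fun m σ => by rw [othersList_reverseCycle]) fun σ => List.pairwise_reverse.2 <|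
      (pairwise_cons_othersList σ i).imp fun h h' => h h'.symm
  have hrev : ∀ σ : Equiv.Perm (Fin n),
      ((i :: othersList σ i).reverse.map fun j => (cycProd A σ j).re).prod =
        ((i :: othersList σ i).map fun j => (cycProd A σ j).re).prod := fun σ =>
    ((List.reverse_perm _).map _).prod_eq
  simp only [hrev, prod_cons_othersList fun a b => re_cycProd_eq_of_sameCycle A] at h
  simpa only [cdet, hermitianDet, List.reverse_cons, List.map_append, List.map_cons, List.map_nil, List.prod_append,
    List.prod_singleton] using h

/-- All row and column determinants of a Hermitian quaternion
matrix coincide, and their common value is real. -/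
theorem hermitian_rdet_cdet_eq_and_real {n : ℕ} (A : Matrix (Fin n) (Fin n) ℍ)
    (hA : Aᴴ = A) :
    (∀ i j : Fin n, rdet A i = rdet A j) ∧
    (∀ i j : Fin n, cdet A i = cdet A j) ∧
    (∀ i j : Fin n, rdet A i = cdet A j) ∧
    (∀ i : Fin n, ∃ r : ℝ, rdet A i = (r : ℍ)) := by
  exact ⟨fun i j => by rw [rdet_eq_hermitianDet hA, rdet_eq_hermitianDet hA],
    fun i j => by rw [cdet_eq_hermitianDet hA, cdet_eq_hermitianDet hA],
    fun i j => by rw [rdet_eq_hermitianDet hA, cdet_eq_hermitianDet hA],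
    fun i => ⟨hermitianDet A, rdet_eq_hermitianDet hA i⟩⟩
end
end

section
/- Let A ∈ ℍ^{m×n} have rank r. Then the entries of the Moore–Penrose inverse A^+ = (a^+_{ij}) ∈ ℍ^{n×m} are given by a^+_{ij} = [Σ_{α ∈ I_{r,m}{j}} rdet_j(((AA*)_{j.}(a*_{i.}))^α_α)] / [Σ_{α ∈ I_{r,m}} |(AA*)^α_α|] for all i = 1,…,n and j = 1,…,m, where a*_{i.} is the i-th row of A*. -/
open Matrix
open scoped Classical

noncomputable section

local notation "ℍ" => Quaternion ℝ

/-! ### Signed sums over simple paths -/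

/-- The signed sum, over all simple paths `a → k₁ → ⋯ → kₗ → b` with distinct intermediate
vertices in `β`, of the product of the entries of `H` along the path times the value of `f` at
the set of unused vertices; the sign is `(-1)^l`. -/
def pathSum {n : ℕ} (H : Matrix (Fin n) (Fin n) ℍ) (f : Finset (Fin n) → ℍ)
    (β : Finset (Fin n)) (a b : Fin n) : ℍ :=
  H a b * f β - ∑ k : β, H a k * pathSum H f (β.erase k) k b
termination_by β.card
decreasing_by exact Finset.card_erase_lt_of_mem k.2

section PathSum

variable {n : ℕ} (H : Matrix (Fin n) (Fin n) ℍ)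

lemma pathSum_eq (f : Finset (Fin n) → ℍ) (β : Finset (Fin n)) (a b : Fin n) :
    pathSum H f β a b = H a b * f β - ∑ k ∈ β, H a k * pathSum H f (β.erase k) k b := by
  rw [pathSum]
  congr 1
  exact Finset.sum_coe_sort β fun k => H a k * pathSum H f (β.erase k) k b

lemma sum_sum_erase_comm {ι M : Type*} [DecidableEq ι] [AddCommMonoid M] (β : Finset ι)
    (G : ι → ι → M) :
    ∑ l ∈ β, ∑ k ∈ β.erase l, G l k = ∑ k ∈ β, ∑ l ∈ β.erase k, G l k := by
  refine Finset.sum_comm' fun x y => ?_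
  simp only [Finset.mem_erase]
  tauto

lemma pathSum_map {p : ℕ} (e : Fin p ↪o Fin n) (H' : Matrix (Fin p) (Fin p) ℍ)
    (f' : Finset (Fin p) → ℍ) (f : Finset (Fin n) → ℍ) (β : Finset (Fin p)) (a b : Fin p)
    (hH : ∀ x ∈ insert a β, ∀ y, H' x y = H (e x) (e y))
    (hf : ∀ γ ⊆ β, f' γ = f (γ.map e.toEmbedding)) :
    pathSum H' f' β a b = pathSum H f (β.map e.toEmbedding) (e a) (e b) := by
  induction β using Finset.strongInduction generalizing a with
  | H β ih =>
    rw [pathSum_eq, pathSum_eq, Finset.sum_map, hf β subset_rfl,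
      hH a (Finset.mem_insert_self _ _)]
    congr 1
    refine Finset.sum_congr rfl fun k hk => ?_
    rw [hH a (Finset.mem_insert_self _ _), ih _ (Finset.erase_ssubset hk) k]
    · rw [Finset.map_erase]
      rfl
    · intro x hx
      rw [Finset.insert_erase hk] at hx
      exact hH x (Finset.mem_insert_of_mem hx)
    · exact fun γ hγ => hf γ (hγ.trans (Finset.erase_subset _ _))

lemma pathSum_congr {f g : Finset (Fin n) → ℍ} {β : Finset (Fin n)}
    (hfg : ∀ γ ⊆ β, f γ = g γ) (a b : Fin n) :
    pathSum H f β a b = pathSum H g β a b := by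
  simpa using pathSum_map H (RelEmbedding.refl _) H f g β a b (fun _ _ _ => rfl)
    (fun γ hγ => by simpa using hfg γ hγ)

lemma pathSum_mul_right (f : Finset (Fin n) → ℍ) (q : ℍ) (β : Finset (Fin n)) (a b : Fin n) :
    pathSum H (fun γ => f γ * q) β a b = pathSum H f β a b * q := by
  induction β using Finset.strongInduction generalizing a with
  | H β ih =>
    rw [pathSum_eq, pathSum_eq, sub_mul, Finset.sum_mul, mul_assoc]
    congr 1
    refine Finset.sum_congr rfl fun k hk => ?_
    rw [ih _ (Finset.erase_ssubset hk), mul_assoc]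

lemma pathSum_sub (f g : Finset (Fin n) → ℍ) (β : Finset (Fin n)) (a b : Fin n) :
    pathSum H (fun γ => f γ - g γ) β a b = pathSum H f β a b - pathSum H g β a b := by
  induction β using Finset.strongInduction generalizing a with
  | H β ih =>
    rw [pathSum_eq, pathSum_eq H f, pathSum_eq H g, Finset.sum_congr rfl fun k hk => by
      rw [ih _ (Finset.erase_ssubset hk), mul_sub], Finset.sum_sub_distrib, mul_sub]
    abel

/-- Marking one of the unused vertices commutes with summing over paths. -/
lemma pathSum_sum_erase (F : Fin n → Finset (Fin n) → ℍ) (β : Finset (Fin n)) (a b : Fin n) :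
    pathSum H (fun γ => ∑ k ∈ γ, F k (γ.erase k)) β a b =
      ∑ k ∈ β, pathSum H (F k) (β.erase k) a b := by
  induction β using Finset.strongInduction generalizing a with
  | H β ih =>
    have hsum : ∑ l ∈ β, H a l * pathSum H (fun γ => ∑ k ∈ γ, F k (γ.erase k)) (β.erase l) l b =
        ∑ k ∈ β, ∑ l ∈ β.erase k, H a l * pathSum H (F k) ((β.erase k).erase l) l b := by
      rw [← sum_sum_erase_comm]
      refine Finset.sum_congr rfl fun l hl => ?_
      rw [ih _ (Finset.erase_ssubset hl), Finset.mul_sum]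
      exact Finset.sum_congr rfl fun k _ => by rw [Finset.erase_right_comm]
    rw [pathSum_eq, hsum, Finset.mul_sum, ← Finset.sum_sub_distrib]
    exact Finset.sum_congr rfl fun k _ => (pathSum_eq H (F k) _ _ _).symm

/-- Splitting the paths according to whether they pass through `i`. -/
lemma pathSum_insert (f : Finset (Fin n) → ℍ) {β : Finset (Fin n)} {i : Fin n} (hi : i ∉ β)
    (a b : Fin n) :
    pathSum H f (insert i β) a b =
      pathSum H (fun γ => f (insert i γ)) β a b
        - pathSum H (fun γ => pathSum H f γ i b) β a i := by
  induction β using Finset.strongInduction generalizing a with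
  | H β ih =>
    have hsum : ∑ k ∈ β, H a k * pathSum H f ((insert i β).erase k) k b =
        ∑ k ∈ β, H a k * pathSum H (fun γ => f (insert i γ)) (β.erase k) k b
          - ∑ k ∈ β, H a k * pathSum H (fun γ => pathSum H f γ i b) (β.erase k) k i := by
      rw [← Finset.sum_sub_distrib]
      refine Finset.sum_congr rfl fun k hk => ?_
      rw [Finset.erase_insert_of_ne (by rintro rfl; exact hi hk),
        ih _ (Finset.erase_ssubset hk) (fun h => hi (Finset.mem_of_mem_erase h)), mul_sub]
    rw [pathSum_eq, Finset.sum_insert hi, Finset.erase_insert hi, hsum,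
      pathSum_eq H (fun γ => f (insert i γ)), pathSum_eq H (fun γ => pathSum H f γ i b)]
    abel

variable (φ : Finset (Fin n) → ℝ)

lemma pathSum_coe_eq_right (β : Finset (Fin n)) (a b : Fin n) :
    pathSum H (fun γ => (φ γ : ℍ)) β a b =
      H a b * (φ β : ℍ) - ∑ k ∈ β, pathSum H (fun γ => (φ γ : ℍ)) (β.erase k) a k * H k b := by
  induction β using Finset.strongInduction generalizing a with
  | H β ih =>
    have hleft : ∑ k ∈ β, H a k * pathSum H (fun γ => (φ γ : ℍ)) (β.erase k) k b =
        ∑ k ∈ β, H a k * (H k b * (φ (β.erase k) : ℍ)) - ∑ k ∈ β, ∑ l ∈ β.erase k,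
          H a k * (pathSum H (fun γ => (φ γ : ℍ)) ((β.erase k).erase l) k l * H l b) := by
      rw [← Finset.sum_sub_distrib]
      refine Finset.sum_congr rfl fun k hk => ?_
      rw [ih _ (Finset.erase_ssubset hk), mul_sub, Finset.mul_sum]
    have hright : ∑ l ∈ β, pathSum H (fun γ => (φ γ : ℍ)) (β.erase l) a l * H l b =
        ∑ l ∈ β, H a l * (H l b * (φ (β.erase l) : ℍ)) - ∑ l ∈ β, ∑ k ∈ β.erase l,
          H a k * (pathSum H (fun γ => (φ γ : ℍ)) ((β.erase k).erase l) k l * H l b) := by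
      rw [← Finset.sum_sub_distrib]
      refine Finset.sum_congr rfl fun l _ => ?_
      rw [pathSum_eq, sub_mul, Finset.sum_mul, mul_assoc, Quaternion.coe_commutes]
      congr 1
      exact Finset.sum_congr rfl fun k _ => by rw [Finset.erase_right_comm, mul_assoc]
    rw [pathSum_eq, hleft, hright, sum_sum_erase_comm]

/-- Cyclicity of the real part for pairs of disjoint paths. -/
lemma re_mul_pathSum_pathSum (q : ℍ) (β : Finset (Fin n)) (a b c d : Fin n) :
    (q * pathSum H (fun γ => pathSum H (fun δ => (φ δ : ℍ)) γ c d) β a b).re =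
      (pathSum H (fun γ => q * pathSum H (fun δ => (φ δ : ℍ)) γ a b) β c d).re := by
  induction β using Finset.strongInduction generalizing a q with
  | H β ih =>
    have hexp : (fun γ => q * pathSum H (fun δ => (φ δ : ℍ)) γ a b) = fun γ =>
        (φ γ : ℍ) * (q * H a b) -
          ∑ k ∈ γ, (q * H a k) * pathSum H (fun δ => (φ δ : ℍ)) (γ.erase k) k b := by
      funext γ
      rw [pathSum_eq, mul_sub, Finset.mul_sum, Quaternion.coe_commutes, mul_assoc]
      simp only [mul_assoc]
    rw [hexp, pathSum_sub, pathSum_mul_right,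
      pathSum_sum_erase H fun k γ => (q * H a k) * pathSum H (fun δ => (φ δ : ℍ)) γ k b,
      pathSum_eq, mul_sub, Finset.mul_sum, Quaternion.re_sub, Quaternion.re_sub,
      ← mul_assoc]
    have hre : ∀ x y : ℍ, (x * y).re = (y * x).re := fun x y => by
      simp only [Quaternion.re_mul]; ring
    rw [hre]
    congr 1
    have hsum : ∀ (s : Finset (Fin n)) (F : Fin n → ℍ),
        (∑ k ∈ s, F k).re = ∑ k ∈ s, (F k).re := fun s F =>
      map_sum (QuaternionAlgebra.reₗ _ _ _) F s
    rw [hsum, hsum]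
    refine Finset.sum_congr rfl fun k hk => ?_
    rw [← mul_assoc, ih _ (Finset.erase_ssubset hk)]

variable {H}

lemma star_pathSum_coe (hH : ∀ a b, star (H a b) = H b a)
    (β : Finset (Fin n)) (a b : Fin n) :
    star (pathSum H (fun γ => (φ γ : ℍ)) β a b) = pathSum H (fun γ => (φ γ : ℍ)) β b a := by
  induction β using Finset.strongInduction generalizing a with
  | H β ih =>
    rw [pathSum_eq, pathSum_coe_eq_right, star_sub, star_sum, star_mul, hH,
      Quaternion.star_coe, Quaternion.coe_commutes]
    congr 1
    refine Finset.sum_congr rfl fun k hk => ?_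
    rw [star_mul, ih _ (Finset.erase_ssubset hk), hH]

lemma pathSum_coe_self (hH : ∀ a b, star (H a b) = H b a)
    (β : Finset (Fin n)) (a : Fin n) :
    pathSum H (fun γ => (φ γ : ℍ)) β a a =
      ((pathSum H (fun γ => (φ γ : ℍ)) β a a).re : ℍ) :=
  Quaternion.star_eq_self.mp (star_pathSum_coe φ hH β a a)

lemma star_pathSum_pathSum (hH : ∀ a b, star (H a b) = H b a)
    (β : Finset (Fin n)) (a b c d : Fin n) :
    star (pathSum H (fun γ => pathSum H (fun δ => (φ δ : ℍ)) γ c d) β a b) =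
      pathSum H (fun γ => pathSum H (fun δ => (φ δ : ℍ)) γ b a) β d c := by
  induction β using Finset.strongInduction generalizing a with
  | H β ih =>
    have hexp : (fun γ => pathSum H (fun δ => (φ δ : ℍ)) γ b a) = fun γ =>
        (φ γ : ℍ) * H b a -
          ∑ k ∈ γ, pathSum H (fun δ => (φ δ : ℍ)) (γ.erase k) b k * H k a := by
      funext γ
      rw [pathSum_coe_eq_right, Quaternion.coe_commutes]
    rw [hexp, pathSum_sub, pathSum_mul_right,
      pathSum_sum_erase H fun k γ => pathSum H (fun δ => (φ δ : ℍ)) γ b k * H k a,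
      pathSum_eq, star_sub, star_mul, hH, star_sum, star_pathSum_coe φ hH]
    congr 1
    refine Finset.sum_congr rfl fun k hk => ?_
    rw [star_mul, ih _ (Finset.erase_ssubset hk), hH, pathSum_mul_right]

/-- A family of central values satisfying the cycle expansion at the least element satisfies it
at every element. -/
lemma eq_pathSum_of_eq_pathSum_min (hH : ∀ a b, star (H a b) = H b a)
    {T : Finset (Fin n) → ℍ} (h0 : T ∅ = 1)
    (hT : ∀ α : Finset (Fin n), ∀ j ∈ α, (∀ x ∈ α, j ≤ x) →
      T α = pathSum H T (α.erase j) j j) (α : Finset (Fin n)) :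
    T α = ((T α).re : ℍ) ∧ ∀ j ∈ α, T α = pathSum H T (α.erase j) j j := by
  induction α using Finset.strongInduction with
  | H α ih =>
    have hcoe : ∀ β ⊂ α, ∀ a b,
        pathSum H T β a b = pathSum H (fun γ => ((T γ).re : ℍ)) β a b := fun β hβ a b =>
      pathSum_congr H (fun γ hγ => (ih γ (hγ.trans_ssubset hβ)).1) a b
    have hreal : ∀ j ∈ α, pathSum H T (α.erase j) j j =
        ((pathSum H T (α.erase j) j j).re : ℍ) := fun j hj => by
      rw [hcoe _ (Finset.erase_ssubset hj)]
      exact pathSum_coe_self _ hH _ _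
    have hsymm : ∀ i ∈ α, ∀ j ∈ α, pathSum H T (α.erase j) j j =
        pathSum H T (α.erase i) i i := by
      intro i hi j hj
      obtain rfl | hij := eq_or_ne i j
      · rfl
      set β := (α.erase j).erase i with hβ
      have key : ∀ i ∈ α, ∀ j ∈ α, i ≠ j → β = (α.erase j).erase i →
          pathSum H T (α.erase j) j j =
            pathSum H (fun γ => pathSum H (fun δ => ((T δ).re : ℍ)) γ i i) β j j -
            pathSum H (fun γ => pathSum H (fun δ => ((T δ).re : ℍ)) γ i j) β j i := by
        intro i hi j hj hij hβ
        have hss : β ⊂ α := hβ ▸ (Finset.erase_subset _ _).trans_ssubset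
          (Finset.erase_ssubset hj)
        have hiβ : i ∉ β := by simp [hβ]
        have hins : insert i β = α.erase j := by
          rw [hβ, Finset.insert_erase (Finset.mem_erase.2 ⟨hij, hi⟩)]
        rw [← hins, pathSum_insert H T hiβ]
        congr 1
        · refine pathSum_congr H (fun γ hγ => ?_) _ _
          have hlt : insert i γ ⊂ α :=
            (Finset.insert_subset_insert i hγ).trans_ssubset
              (hins ▸ Finset.erase_ssubset hj)
          rw [(ih _ hlt).2 i (Finset.mem_insert_self _ _),
            Finset.erase_insert fun h => hiβ (hγ h), hcoe _ (hγ.trans_ssubset hss)]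
        · exact pathSum_congr H (fun γ hγ => hcoe _ (hγ.trans_ssubset hss) _ _) _ _
      rw [hreal j hj, hreal i hi, key i hi j hj hij hβ,
        key j hj i hi hij.symm (hβ.trans Finset.erase_right_comm), Quaternion.re_sub,
        Quaternion.re_sub]
      congr 2
      · rw [← star_pathSum_pathSum _ hH, Quaternion.re_star]
      · simpa using re_mul_pathSum_pathSum H (fun δ => (T δ).re) 1 β j i i j
    obtain rfl | hne := α.eq_empty_or_nonempty
    · simp only [h0, Finset.notMem_empty, IsEmpty.forall_iff, implies_true, and_true]
      exact Quaternion.coe_one.symm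
    · have hmin := hT α (α.min' hne) (α.min'_mem hne) fun x hx => α.min'_le x hx
      refine ⟨?_, fun j hj => hmin.trans (hsymm _ hj _ (α.min'_mem hne))⟩
      rw [hmin]
      exact hreal _ (α.min'_mem hne)

/-- The expansion along a row which is repeated vanishes. -/
lemma pathSum_eq_zero_of_mem (hH : ∀ a b, star (H a b) = H b a)
    {T : Finset (Fin n) → ℍ}
    (hT : ∀ α, T α = ((T α).re : ℍ) ∧ ∀ j ∈ α, T α = pathSum H T (α.erase j) j j)
    {β : Finset (Fin n)} {i : Fin n} (hi : i ∈ β) (j : Fin n) :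
    pathSum H T β i j = 0 := by
  have hcoe : T = fun γ => ((T γ).re : ℍ) := funext fun γ => (hT γ).1
  obtain ⟨γ, hiγ, rfl⟩ : ∃ γ, i ∉ γ ∧ insert i γ = β :=
    ⟨β.erase i, Finset.notMem_erase _ _, Finset.insert_erase hi⟩
  have hins : ∀ δ ⊆ γ, T (insert i δ) = pathSum H T δ i i := fun δ hδ => by
    rw [(hT _).2 i (Finset.mem_insert_self _ _), Finset.erase_insert fun h => hiγ (hδ h)]
  rw [pathSum_insert H T hiγ, sub_eq_zero, pathSum_congr H hins]
  apply star_injective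
  rw [hcoe, star_pathSum_pathSum _ hH γ i i i j]
  have hreal : (fun δ => pathSum H (fun γ => ((T γ).re : ℍ)) δ i i) = fun δ =>
      ((pathSum H (fun γ => ((T γ).re : ℍ)) δ i i).re : ℍ) :=
    funext fun δ => pathSum_coe_self _ hH δ i
  rw [hreal]
  exact star_pathSum_coe _ hH _ _ _

end PathSum

/-! ### Determinants supported on a set of indices -/

section Permutations

open Equiv

variable {n : ℕ}

/-- The minimal elements of the `σ`-cycles contained in `α`, in increasing order. -/
def leaderList (α : Finset (Fin n)) (σ : Perm (Fin n)) : List (Fin n) :=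
  (α.filter fun j => ∀ t, σ.SameCycle j t → j ≤ t).sort (· ≤ ·)

/-- The minimal elements of the `σ`-cycles contained in `α` and not containing `i`, in
increasing order. -/
def otherLeaderList (α : Finset (Fin n)) (σ : Perm (Fin n)) (i : Fin n) : List (Fin n) :=
  (α.filter fun j => ¬ σ.SameCycle i j ∧ ∀ t, σ.SameCycle j t → j ≤ t).sort (· ≤ ·)

/-- The permutations fixing every index outside `α`. -/
def permsOn (α : Finset (Fin n)) : Finset (Perm (Fin n)) :=
  Finset.univ.filter fun σ => ∀ x, x ∉ α → σ x = x

lemma mem_permsOn {α : Finset (Fin n)} {σ : Perm (Fin n)} :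
    σ ∈ permsOn α ↔ ∀ x, x ∉ α → σ x = x := by
  simp [permsOn]

/-- The determinant of the principal part of `M` with indices in `α`. -/
def principalDet (M : Matrix (Fin n) (Fin n) ℍ) (α : Finset (Fin n)) : ℍ :=
  ∑ σ ∈ permsOn α, ((Perm.sign σ : ℤ) • ((leaderList α σ).map (cycProd M σ)).prod)

/-- The `j`-th row determinant of the principal part of `M` with indices in `α`, the `j`-th row
being replaced by `v`. -/
def principalRowDet (M : Matrix (Fin n) (Fin n) ℍ) (α : Finset (Fin n)) (v : Fin n → ℍ)
    (j : Fin n) : ℍ :=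
  ∑ σ ∈ permsOn α, ((Perm.sign σ : ℤ) •
    (cycProd (M.updateRow j v) σ j * ((otherLeaderList α σ j).map (cycProd M σ)).prod))

lemma qdet_eq_principalDet (M : Matrix (Fin n) (Fin n) ℍ) :
    qdet M = principalDet M Finset.univ := by
  have h : permsOn (Finset.univ : Finset (Fin n)) = Finset.univ := by
    ext σ; simp [mem_permsOn]
  rw [qdet, principalDet, h]
  rfl

lemma rdet_eq_principalRowDet (M : Matrix (Fin n) (Fin n) ℍ) (i : Fin n) :
    rdet M i = principalRowDet M Finset.univ (M i) i := by
  have h : permsOn (Finset.univ : Finset (Fin n)) = Finset.univ := by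
    ext σ; simp [mem_permsOn]
  rw [rdet, principalRowDet, h, Matrix.updateRow_eq_self]
  rfl

lemma principalDet_empty (M : Matrix (Fin n) (Fin n) ℍ) : principalDet M ∅ = 1 := by
  have h : permsOn (∅ : Finset (Fin n)) = {1} := by
    ext σ
    simp [mem_permsOn, Perm.ext_iff]
  simp [principalDet, h, leaderList]

lemma mem_iff_of_sameCycle {α : Finset (Fin n)} {σ : Perm (Fin n)} (hσ : σ ∈ permsOn α)
    {x y : Fin n} (h : σ.SameCycle x y) : x ∈ α ↔ y ∈ α := by
  rw [mem_permsOn] at hσ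
  by_cases hx : x ∈ α
  · refine iff_of_true hx ?_
    by_contra hy
    exact hy (h.symm.eq_of_left (hσ y hy) ▸ hx)
  · rw [h.eq_of_left (hσ x hx)]

lemma leaderList_eq_cons {α : Finset (Fin n)} {σ : Perm (Fin n)} (hσ : σ ∈ permsOn α)
    {j : Fin n} (hj : j ∈ α) (hmin : ∀ x ∈ α, j ≤ x) :
    leaderList α σ = j :: otherLeaderList α σ j := by
  have hset : (α.filter fun j => ∀ t, σ.SameCycle j t → j ≤ t) =
      insert j (α.filter fun i => ¬ σ.SameCycle j i ∧ ∀ t, σ.SameCycle i t → i ≤ t) := by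
    ext x
    simp only [Finset.mem_filter, Finset.mem_insert]
    constructor
    · rintro ⟨hx, hlead⟩
      by_cases hjx : σ.SameCycle j x
      · exact Or.inl (le_antisymm (hlead j hjx.symm) (hmin x hx))
      · exact Or.inr ⟨hx, hjx, hlead⟩
    · rintro (rfl | ⟨hx, -, hlead⟩)
      · exact ⟨hj, fun t ht => hmin t ((mem_iff_of_sameCycle hσ ht).1 hj)⟩
      · exact ⟨hx, hlead⟩
  rw [leaderList, otherLeaderList, hset]
  refine Finset.sort_insert (· ≤ ·) (fun x hx => hmin x (Finset.mem_filter.1 hx).1) ?_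
  exact fun h => (Finset.mem_filter.1 h).2.1 (Perm.SameCycle.refl _ _)

lemma principalDet_eq_principalRowDet (M : Matrix (Fin n) (Fin n) ℍ) {α : Finset (Fin n)}
    {j : Fin n} (hj : j ∈ α) (hmin : ∀ x ∈ α, j ≤ x) :
    principalDet M α = principalRowDet M α (M j) j := by
  refine Finset.sum_congr rfl fun σ hσ => ?_
  rw [leaderList_eq_cons hσ hj hmin, List.map_cons, List.prod_cons, Matrix.updateRow_eq_self]

lemma otherLeaderList_of_fixed {α : Finset (Fin n)} {σ : Perm (Fin n)} {j : Fin n}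
    (h : σ j = j) : otherLeaderList α σ j = leaderList (α.erase j) σ := by
  rw [otherLeaderList, leaderList]
  congr 1
  ext x
  have hx : σ.SameCycle j x ↔ x = j :=
    ⟨fun hs => (hs.eq_of_left h).symm, fun hs => hs ▸ Perm.SameCycle.refl _ _⟩
  simp only [Finset.mem_filter, Finset.mem_erase, hx]
  tauto

lemma cycProd_of_fixed (M : Matrix (Fin n) (Fin n) ℍ) {σ : Perm (Fin n)} {j : Fin n}
    (h : σ j = j) : cycProd M σ j = M j j := by
  have hp : Function.minimalPeriod σ j = 1 := Function.minimalPeriod_eq_one_iff_isFixedPt.2 h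
  simp [cycProd, hp, h]

section Shortcut

variable {σ : Perm (Fin n)} {j : Fin n}

lemma pow_apply_eq_self_iff (t : ℕ) :
    (σ ^ t) j = j ↔ Function.minimalPeriod σ j ∣ t := by
  rw [← Function.isPeriodicPt_iff_minimalPeriod_dvd, Function.IsPeriodicPt, Function.IsFixedPt,
    Perm.iterate_eq_pow]

lemma minimalPeriod_pos (σ : Perm (Fin n)) (j : Fin n) : 0 < Function.minimalPeriod σ j :=
  Function.minimalPeriod_pos_of_mem_periodicPts
    ((Function.Injective.mem_periodicPts σ.injective) j)

lemma shortcut_apply_of_ne {x : Fin n} (hj : x ≠ j) (hk : x ≠ σ j) :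
    (σ * swap j (σ j)) x = σ x := by
  rw [Perm.mul_apply, swap_apply_of_ne_of_ne hj hk]

lemma shortcut_pow_apply {t : ℕ} (h1 : 1 ≤ t) (ht : t < Function.minimalPeriod σ j) :
    ((σ * swap j (σ j)) ^ t) j = (σ ^ (t + 1)) j := by
  induction t, h1 using Nat.le_induction with
  | base => simp [pow_succ]
  | succ t h1 ih =>
    rw [pow_succ', Perm.mul_apply, ih (by omega), shortcut_apply_of_ne, pow_succ' σ (t + 1),
      Perm.mul_apply]
    · intro h
      exact absurd (Nat.le_of_dvd (by omega) ((pow_apply_eq_self_iff _).1 h)) (by omega)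
    · intro h
      rw [pow_succ', Perm.mul_apply, σ.injective.eq_iff, pow_apply_eq_self_iff] at h
      exact absurd (Nat.le_of_dvd (by omega) h) (by omega)

lemma minimalPeriod_shortcut (h : σ j ≠ j) :
    Function.minimalPeriod (σ * swap j (σ j)) j + 1 = Function.minimalPeriod σ j := by
  have hpos := minimalPeriod_pos σ j
  have hpos' := minimalPeriod_pos (σ * swap j (σ j)) j
  have hne : Function.minimalPeriod σ j ≠ 1 := fun h1 =>
    h (Function.minimalPeriod_eq_one_iff_isFixedPt.1 h1)
  have hle : Function.minimalPeriod (σ * swap j (σ j)) j ≤ Function.minimalPeriod σ j - 1 := by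
    refine Nat.le_of_dvd (by omega) ((pow_apply_eq_self_iff _).1 ?_)
    rw [shortcut_pow_apply (by omega) (by omega), pow_apply_eq_self_iff,
      Nat.sub_add_cancel hpos]
  have hself : ((σ * swap j (σ j)) ^ Function.minimalPeriod (σ * swap j (σ j)) j) j = j :=
    (pow_apply_eq_self_iff _).2 dvd_rfl
  rw [shortcut_pow_apply hpos' (by omega), pow_apply_eq_self_iff] at hself
  have := Nat.le_of_dvd (by omega) hself
  omega

lemma cycProd_shortcut (M : Matrix (Fin n) (Fin n) ℍ) (v : Fin n → ℍ) (h : σ j ≠ j) :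
    cycProd (M.updateRow j v) σ j =
      v (σ j) * cycProd (M.updateRow j (M (σ j))) (σ * swap j (σ j)) j := by
  have hpos' := minimalPeriod_pos (σ * swap j (σ j)) j
  have hp := minimalPeriod_shortcut h
  rw [cycProd, cycProd, ← hp, List.range_succ_eq_map, List.map_cons, List.prod_cons,
    List.map_map]
  congr 1
  · simp
  · congr 1
    refine List.map_congr_left fun t ht => ?_
    have ht := List.mem_range.1 ht
    rw [Function.comp_apply, Nat.succ_eq_add_one, shortcut_pow_apply (t := t + 1) (by omega) (by omega)]
    rcases Nat.eq_zero_or_pos t with rfl | htpos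
    · simp [Matrix.updateRow_ne h]
    · have hne : (σ ^ (t + 1)) j ≠ j := fun he => absurd
        (Nat.le_of_dvd (by omega) ((pow_apply_eq_self_iff _).1 he)) (by omega)
      rw [shortcut_pow_apply htpos (by omega), Matrix.updateRow_ne hne, Matrix.updateRow_ne hne]

lemma shortcut_pow_apply_of_not_sameCycle {x : Fin n} (hx : ¬ σ.SameCycle j x) (t : ℕ) :
    ((σ * swap j (σ j)) ^ t) x = (σ ^ t) x := by
  induction t with
  | zero => rfl
  | succ t ih =>
    have hc : ¬ σ.SameCycle j ((σ ^ t) x) := by rwa [Perm.sameCycle_pow_right]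
    rw [pow_succ', Perm.mul_apply, ih, shortcut_apply_of_ne, pow_succ', Perm.mul_apply]
    · rintro he
      exact hc (he ▸ Perm.SameCycle.refl _ _)
    · rintro he
      exact hc (he ▸ (Perm.sameCycle_apply_right.2 (Perm.SameCycle.refl _ _)))

lemma cycProd_shortcut_of_not_sameCycle (M : Matrix (Fin n) (Fin n) ℍ) {x : Fin n}
    (hx : ¬ σ.SameCycle j x) : cycProd M (σ * swap j (σ j)) x = cycProd M σ x := by
  have hp : Function.minimalPeriod (σ * swap j (σ j)) x = Function.minimalPeriod σ x := by
    refine Nat.dvd_antisymm ?_ ?_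
    · rw [← pow_apply_eq_self_iff, shortcut_pow_apply_of_not_sameCycle hx,
        pow_apply_eq_self_iff]
    · rw [← pow_apply_eq_self_iff, ← shortcut_pow_apply_of_not_sameCycle hx,
        pow_apply_eq_self_iff]
  rw [cycProd, cycProd, hp]
  simp only [shortcut_pow_apply_of_not_sameCycle hx]

lemma sameCycle_shortcut_of_not_sameCycle {x : Fin n} (hx : ¬ σ.SameCycle j x) (y : Fin n) :
    (σ * swap j (σ j)).SameCycle x y ↔ σ.SameCycle x y := by
  constructor
  · intro hs
    obtain ⟨t, -, rfl⟩ := hs.exists_pow_eq'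
    rw [shortcut_pow_apply_of_not_sameCycle hx]
    exact Perm.sameCycle_pow_right.2 (Perm.SameCycle.refl _ _)
  · intro hs
    obtain ⟨t, -, rfl⟩ := hs.exists_pow_eq'
    rw [← shortcut_pow_apply_of_not_sameCycle hx]
    exact Perm.sameCycle_pow_right.2 (Perm.SameCycle.refl _ _)

lemma sameCycle_iff_shortcut (x : Fin n) :
    σ.SameCycle j x ↔ x = σ j ∨ (σ * swap j (σ j)).SameCycle j x := by
  constructor
  · intro hs
    obtain ⟨t, -, rfl⟩ := hs.exists_pow_eq'
    clear hs
    induction t with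
    | zero => exact Or.inr (Perm.SameCycle.refl _ _)
    | succ t ih =>
      rw [pow_succ', Perm.mul_apply]
      set x := (σ ^ t) j
      by_cases hxj : x = j
      · exact Or.inl (by rw [hxj])
      by_cases hxk : x = σ j
      · refine Or.inr ?_
        have hσx : σ x = (σ * swap j (σ j)) j := by simp [hxk]
        rw [hσx]
        exact Perm.sameCycle_apply_right.2 (Perm.SameCycle.refl _ _)
      · refine Or.inr ?_
        rw [← shortcut_apply_of_ne hxj hxk]
        exact Perm.sameCycle_apply_right.2 (ih.resolve_left hxk)
  · rintro (rfl | hs)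
    · exact Perm.sameCycle_apply_right.2 (Perm.SameCycle.refl _ _)
    · by_contra hx
      exact hx ((sameCycle_shortcut_of_not_sameCycle hx j).1 hs.symm).symm

lemma otherLeaderList_shortcut (α : Finset (Fin n)) :
    otherLeaderList (α.erase (σ j)) (σ * swap j (σ j)) j = otherLeaderList α σ j := by
  rw [otherLeaderList, otherLeaderList]
  congr 1
  ext x
  simp only [Finset.mem_filter, Finset.mem_erase]
  have hiff := sameCycle_iff_shortcut (σ := σ) (j := j) x
  by_cases hx : σ.SameCycle j x
  · simp only [hx, not_true_eq_false, false_and, and_false, iff_false, not_and]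
    intro hne hs
    exact absurd ((hiff.1 hx).resolve_left hne.1) hs
  · simp only [sameCycle_shortcut_of_not_sameCycle hx]
    tauto

end Shortcut

lemma principalRowDet_eq (M : Matrix (Fin n) (Fin n) ℍ) {α : Finset (Fin n)} (v : Fin n → ℍ)
    {j : Fin n} (hj : j ∈ α) :
    principalRowDet M α v j = v j * principalDet M (α.erase j) -
      ∑ k ∈ α.erase j, v k * principalRowDet M (α.erase k) (M k) j := by
  have hmaps : ∀ σ ∈ permsOn α, σ j ∈ α := fun σ hσ =>
    (mem_iff_of_sameCycle hσ (Perm.sameCycle_apply_right.2 (Perm.SameCycle.refl σ j))).1 hj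
  rw [principalRowDet, ← Finset.sum_fiberwise_of_maps_to hmaps, ← Finset.add_sum_erase _ _ hj,
    sub_eq_add_neg, ← Finset.sum_neg_distrib]
  congr 1
  · have hset : (permsOn α).filter (fun σ => σ j = j) = permsOn (α.erase j) := by
      ext σ
      simp only [Finset.mem_filter, mem_permsOn, Finset.mem_erase, not_and]
      constructor
      · rintro ⟨h, hfix⟩ x hx
        obtain rfl | hne := eq_or_ne x j
        · exact hfix
        · exact h x (hx hne)
      · exact fun h => ⟨fun x hx => h x fun _ => hx, h j fun hne => absurd rfl hne⟩
    rw [hset, principalDet, Finset.mul_sum]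
    refine Finset.sum_congr rfl fun σ hσ => ?_
    have hfix : σ j = j := mem_permsOn.1 hσ j (Finset.notMem_erase _ _)
    rw [otherLeaderList_of_fixed hfix, cycProd_of_fixed _ hfix, Matrix.updateRow_self,
      mul_smul_comm]
  · refine Finset.sum_congr rfl fun k hk => ?_
    have hkj : k ≠ j := Finset.ne_of_mem_erase hk
    rw [principalRowDet, Finset.mul_sum, ← Finset.sum_neg_distrib]
    refine Finset.sum_bij' (fun σ _ => σ * swap j k) (fun σ _ => σ * swap j k) ?_ ?_ ?_ ?_ ?_
    · intro σ hσ
      rw [Finset.mem_filter, mem_permsOn] at hσ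
      rw [mem_permsOn]
      intro x hx
      obtain rfl | hxk := eq_or_ne x k
      · simp [hσ.2]
      · have hxα : x ∉ α := fun h => hx (Finset.mem_erase.2 ⟨hxk, h⟩)
        have hxj : x ≠ j := fun h => hxα (h ▸ hj)
        rw [Perm.mul_apply, swap_apply_of_ne_of_ne hxj hxk, hσ.1 x hxα]
    · intro σ hσ
      rw [mem_permsOn] at hσ
      have hσk : σ k = k := hσ k (Finset.notMem_erase _ _)
      refine Finset.mem_filter.2 ⟨mem_permsOn.2 fun x hx => ?_, by simp [hσk]⟩
      have hxj : x ≠ j := fun h => hx (h ▸ hj)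
      have hxk : x ≠ k := fun h => hx (h ▸ Finset.mem_of_mem_erase hk)
      rw [Perm.mul_apply, swap_apply_of_ne_of_ne hxj hxk,
        hσ x fun h => hx (Finset.mem_of_mem_erase h)]
    · intro σ _; simp [mul_assoc]
    · intro σ _; simp [mul_assoc]
    · intro σ hσ
      obtain rfl := (Finset.mem_filter.1 hσ).2
      have hrest : (otherLeaderList α σ j).map (cycProd M (σ * swap j (σ j))) =
          (otherLeaderList α σ j).map (cycProd M σ) := by
        refine List.map_congr_left fun x hx => ?_
        rw [otherLeaderList, Finset.mem_sort, Finset.mem_filter] at hx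
        exact cycProd_shortcut_of_not_sameCycle M hx.2.1
      rw [otherLeaderList_shortcut, hrest, cycProd_shortcut M v hkj, Perm.sign_mul,
        Perm.sign_swap hkj.symm, mul_neg_one, Units.val_neg, neg_smul, mul_neg, neg_neg,
        mul_smul_comm, mul_assoc]

lemma principalRowDet_insert (M : Matrix (Fin n) (Fin n) ℍ) {β : Finset (Fin n)} {j : Fin n}
    (hj : j ∉ β) (a : Fin n) :
    principalRowDet M (insert j β) (M a) j = pathSum M (principalDet M) β a j := by
  induction β using Finset.strongInduction generalizing a with
  | H β ih =>
    rw [principalRowDet_eq M _ (Finset.mem_insert_self _ _), pathSum_eq,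
      Finset.erase_insert hj]
    congr 1
    refine Finset.sum_congr rfl fun k hk => ?_
    rw [Finset.erase_insert_of_ne (by rintro rfl; exact hj hk),
      ih _ (Finset.erase_ssubset hk) fun h => hj (Finset.mem_of_mem_erase h)]

lemma principalRowDet_eq_pathSum (M : Matrix (Fin n) (Fin n) ℍ) {α : Finset (Fin n)}
    (v : Fin n → ℍ) {j : Fin n} (hj : j ∈ α) :
    principalRowDet M α v j = v j * principalDet M (α.erase j) -
      ∑ k ∈ α.erase j, v k * pathSum M (principalDet M) ((α.erase j).erase k) k j := by
  rw [principalRowDet_eq M v hj]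
  congr 1
  refine Finset.sum_congr rfl fun k hk => ?_
  rw [← principalRowDet_insert M (by simp), Finset.erase_right_comm,
    Finset.insert_erase (Finset.mem_erase.2 ⟨(Finset.ne_of_mem_erase hk).symm, hj⟩)]

lemma principalDet_eq_pathSum (M : Matrix (Fin n) (Fin n) ℍ) {α : Finset (Fin n)} {j : Fin n}
    (hj : j ∈ α) (hmin : ∀ x ∈ α, j ≤ x) :
    principalDet M α = pathSum M (principalDet M) (α.erase j) j j := by
  rw [principalDet_eq_principalRowDet M hj hmin, ← principalRowDet_insert M (by simp),
    Finset.insert_erase hj]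

lemma principalDet_map {p : ℕ} (e : Fin p ↪o Fin n) (M' : Matrix (Fin p) (Fin p) ℍ)
    (M : Matrix (Fin n) (Fin n) ℍ) (α : Finset (Fin p))
    (hM : ∀ x ∈ α, ∀ y, M' x y = M (e x) (e y)) :
    principalDet M' α = principalDet M (α.map e.toEmbedding) := by
  induction α using Finset.strongInduction with
  | H α ih =>
    obtain rfl | hne := α.eq_empty_or_nonempty
    · simp [principalDet_empty]
    · have hj := α.min'_mem hne
      have hmin : ∀ x ∈ α, α.min' hne ≤ x := fun x hx => α.min'_le x hx
      rw [principalDet_eq_pathSum M' hj hmin,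
        principalDet_eq_pathSum M (j := e (α.min' hne)) (Finset.mem_map_of_mem _ hj),
        pathSum_map M e M' _ (principalDet M), Finset.map_erase]
      · rfl
      · rwa [Finset.insert_erase hj]
      · exact fun γ hγ => ih γ (hγ.trans_ssubset (Finset.erase_ssubset hj)) fun x hx =>
          hM x (Finset.mem_of_mem_erase (hγ hx))
      · intro x hx
        obtain ⟨y, hy, rfl⟩ := Finset.mem_map.1 hx
        exact e.monotone (hmin y hy)

lemma map_univ_orderEmbOfFin (α : Finset (Fin n)) :
    Finset.univ.map (α.orderEmbOfFin rfl).toEmbedding = α := by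
  ext x
  simp only [Finset.mem_map, Finset.mem_univ, true_and]
  exact Set.ext_iff.1 (Finset.range_orderEmbOfFin α rfl) x

lemma minorDet_eq_principalDet (M : Matrix (Fin n) (Fin n) ℍ) (α : Finset (Fin n)) :
    minorDet M α = principalDet M α := by
  rw [minorDet, qdet_eq_principalDet,
    principalDet_map (α.orderEmbOfFin rfl) (pSub M α) M _ fun _ _ _ => rfl, map_univ_orderEmbOfFin]

lemma minorRdet_updateRow (M : Matrix (Fin n) (Fin n) ℍ) (v : Fin n → ℍ) {α : Finset (Fin n)}
    {j : Fin n} (hj : j ∈ α) :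
    minorRdet (M.updateRow j v) α j = v j * principalDet M (α.erase j) -
      ∑ k ∈ α.erase j, v k * pathSum M (principalDet M) ((α.erase j).erase k) k j := by
  set e := α.orderEmbOfFin rfl with he
  obtain ⟨i, hi⟩ : j ∈ Set.range e := by
    rw [he, Finset.range_orderEmbOfFin]
    exact hj
  have hidx : (α.orderIsoOfFin rfl).symm ⟨j, hj⟩ = i := by
    rw [OrderIso.symm_apply_eq]
    exact Subtype.ext hi.symm
  have hrow : ∀ y, pSub (M.updateRow j v) α i y = v (e y) := fun y => by
    change M.updateRow j v (e i) (e y) = _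
    rw [hi, Matrix.updateRow_self]
  have hother : ∀ x ∈ Finset.univ.erase i, ∀ y,
      pSub (M.updateRow j v) α x y = M (e x) (e y) := fun x hx y => by
    change M.updateRow j v (e x) (e y) = _
    rw [Matrix.updateRow_ne]
    rw [← hi, Ne, e.injective.eq_iff]
    exact Finset.ne_of_mem_erase hx
  have hmap : (Finset.univ.erase i).map e.toEmbedding = α.erase j := by
    rw [Finset.map_erase, map_univ_orderEmbOfFin]
    exact congrArg _ hi
  rw [minorRdet, dif_pos hj, hidx, rdet_eq_principalRowDet,
    principalRowDet_eq_pathSum _ _ (Finset.mem_univ i), hrow, hi,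
    principalDet_map e _ M _ hother, hmap, ← hmap, Finset.sum_map]
  congr 1
  refine Finset.sum_congr rfl fun k hk => ?_
  rw [hrow, pathSum_map M e _ _ (principalDet M), hi, Finset.map_erase]
  · rfl
  · rwa [Finset.insert_erase hk]
  · exact fun γ hγ => principalDet_map e _ M γ fun x hx =>
      hother x (Finset.mem_of_mem_erase (hγ hx))

end Permutations

/-! ### The coefficients of the characteristic determinant and of the adjugate -/

section Coefficients

variable {n : ℕ}

/-- The sum of all principal minors of order `k`. -/
def minorSum (H : Matrix (Fin n) (Fin n) ℍ) (k : ℕ) : ℍ :=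
  ∑ α ∈ Finset.powersetCard k (Finset.univ : Finset (Fin n)), principalDet H α

/-- The coefficient of the `i`-th entry of the `j`-th row in the `j`-th row determinant of the
principal submatrix with indices in `α`. -/
def rowCofactor (H : Matrix (Fin n) (Fin n) ℍ) (α : Finset (Fin n)) (i j : Fin n) : ℍ :=
  if i = j then principalDet H (α.erase j)
  else if i ∈ α then -pathSum H (principalDet H) ((α.erase j).erase i) i j else 0

/-- The sum of the cofactor matrices of all principal submatrices of order `k`. -/
def cofactorSum (H : Matrix (Fin n) (Fin n) ℍ) (k : ℕ) : Matrix (Fin n) (Fin n) ℍ :=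
  fun i j => ∑ α ∈ (Finset.powersetCard k (Finset.univ : Finset (Fin n))).filter (j ∈ ·),
    rowCofactor H α i j

variable (H : Matrix (Fin n) (Fin n) ℍ)

lemma sum_mul_rowCofactor (v : Fin n → ℍ) {α : Finset (Fin n)} {j : Fin n} (hj : j ∈ α) :
    ∑ i, v i * rowCofactor H α i j = v j * principalDet H (α.erase j) -
      ∑ k ∈ α.erase j, v k * pathSum H (principalDet H) ((α.erase j).erase k) k j := by
  have hsupp : ∑ i ∈ α, v i * rowCofactor H α i j = ∑ i, v i * rowCofactor H α i j := by
    refine Finset.sum_subset (Finset.subset_univ α) fun i _ hi => ?_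
    rw [rowCofactor, if_neg (by rintro rfl; exact hi hj), if_neg hi, mul_zero]
  rw [← hsupp, ← Finset.add_sum_erase _ _ hj, sub_eq_add_neg, ← Finset.sum_neg_distrib,
    rowCofactor, if_pos rfl]
  congr 1
  refine Finset.sum_congr rfl fun k hk => ?_
  rw [rowCofactor, if_neg (Finset.ne_of_mem_erase hk), if_pos (Finset.mem_of_mem_erase hk),
    mul_neg]

lemma sum_minorRdet_updateRow (v : Fin n → ℍ) (k : ℕ) (j : Fin n) :
    ∑ α ∈ (Finset.powersetCard k (Finset.univ : Finset (Fin n))).filter (fun α => j ∈ α),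
      minorRdet (H.updateRow j v) α j = ∑ i, v i * cofactorSum H k i j := by
  simp only [cofactorSum, Finset.mul_sum]
  rw [Finset.sum_comm]
  refine Finset.sum_congr rfl fun α hα => ?_
  have hj := (Finset.mem_filter.1 hα).2
  rw [sum_mul_rowCofactor H v hj, minorRdet_updateRow H v hj]

lemma sum_powersetCard_erase {M : Type*} [AddCommMonoid M] (F : Finset (Fin n) → M) (k : ℕ)
    (j : Fin n) :
    ∑ α ∈ (Finset.powersetCard (k + 1) (Finset.univ : Finset (Fin n))).filter (j ∈ ·),
      F (α.erase j) =
    ∑ β ∈ (Finset.powersetCard k (Finset.univ : Finset (Fin n))).filter (j ∉ ·), F β := by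
  refine Finset.sum_bij' (fun α _ => α.erase j) (fun β _ => insert j β) ?_ ?_ ?_ ?_ ?_
  · intro α hα
    simp only [Finset.mem_filter, Finset.mem_powersetCard_univ] at hα ⊢
    exact ⟨by rw [Finset.card_erase_of_mem hα.2, hα.1, Nat.add_sub_cancel],
      Finset.notMem_erase _ _⟩
  · intro β hβ
    simp only [Finset.mem_filter, Finset.mem_powersetCard_univ] at hβ ⊢
    exact ⟨by rw [Finset.card_insert_of_notMem hβ.2, hβ.1], Finset.mem_insert_self _ _⟩
  · intro α hα
    exact Finset.insert_erase (Finset.mem_filter.1 hα).2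
  · intro β hβ
    exact Finset.erase_insert (Finset.mem_filter.1 hβ).2
  · exact fun _ _ => rfl

lemma cofactorSum_self (k : ℕ) (j : Fin n) :
    cofactorSum H (k + 1) j j =
      ∑ β ∈ (Finset.powersetCard k (Finset.univ : Finset (Fin n))).filter (j ∉ ·),
        principalDet H β := by
  rw [← sum_powersetCard_erase]
  exact Finset.sum_congr rfl fun α _ => if_pos rfl

lemma trace_cofactorSum (k : ℕ) :
    (cofactorSum H (k + 1)).trace = ((n : ℍ) - k) * minorSum H k := by
  simp only [Matrix.trace, Matrix.diag_apply, cofactorSum_self, Finset.sum_filter, minorSum]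
  rw [Finset.sum_comm, Finset.mul_sum]
  refine Finset.sum_congr rfl fun β hβ => ?_
  rw [Finset.mem_powersetCard_univ] at hβ
  have hle : k ≤ n := by
    rw [← hβ]
    exact (Finset.card_le_univ β).trans_eq (Fintype.card_fin n)
  have hcompl : (Finset.univ.filter fun j => j ∉ β) = βᶜ := by
    ext; simp
  rw [← Finset.sum_filter, Finset.sum_const, hcompl, Finset.card_compl, Fintype.card_fin, hβ,
    nsmul_eq_mul, Nat.cast_sub hle]

lemma minorSum_zero : minorSum H 0 = 1 := by
  simp [minorSum, principalDet_empty]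

lemma powersetCard_univ_eq_empty {k : ℕ} (hk : n < k) :
    Finset.powersetCard k (Finset.univ : Finset (Fin n)) = ∅ :=
  Finset.powersetCard_eq_empty.2 (by simpa using hk)

lemma minorSum_of_lt {k : ℕ} (hk : n < k) : minorSum H k = 0 := by
  rw [minorSum, powersetCard_univ_eq_empty hk, Finset.sum_empty]

lemma cofactorSum_of_lt {k : ℕ} (hk : n < k) : cofactorSum H k = 0 := by
  ext1 i j
  rw [cofactorSum, powersetCard_univ_eq_empty hk, Finset.filter_empty, Finset.sum_empty,
    Matrix.zero_apply]

variable {H}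

/-- The recursion of Faddeev and LeVerrier for Hermitian matrices. -/
lemma mul_cofactorSum_add (hH : ∀ a b, star (H a b) = H b a) (k : ℕ) :
    H * cofactorSum H k + cofactorSum H (k + 1) = Matrix.diagonal fun _ => minorSum H k := by
  have hT := eq_pathSum_of_eq_pathSum_min hH (principalDet_empty H) fun α j hj hmin =>
    principalDet_eq_pathSum H hj hmin
  ext1 i j
  have hmul : (H * cofactorSum H k) i j =
      ∑ α ∈ (Finset.powersetCard k (Finset.univ : Finset (Fin n))).filter (j ∈ ·),
        pathSum H (principalDet H) (α.erase j) i j := by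
    simp only [Matrix.mul_apply, cofactorSum, Finset.mul_sum]
    rw [Finset.sum_comm]
    refine Finset.sum_congr rfl fun α hα => ?_
    rw [sum_mul_rowCofactor H (H i) (Finset.mem_filter.1 hα).2, ← pathSum_eq]
  rw [Matrix.add_apply, hmul]
  obtain rfl | hij := eq_or_ne i j
  · rw [Matrix.diagonal_apply_eq, cofactorSum_self, minorSum,
      ← Finset.sum_filter_add_sum_filter_not (Finset.powersetCard k Finset.univ) (i ∈ ·)
        (principalDet H)]
    congr 1
    exact Finset.sum_congr rfl fun α hα => ((hT α).2 i (Finset.mem_filter.1 hα).2).symm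
  · have hcof : cofactorSum H (k + 1) i j =
        ∑ α ∈ (Finset.powersetCard (k + 1) (Finset.univ : Finset (Fin n))).filter (i ∈ ·),
          if j ∈ α.erase i then
            -pathSum H (principalDet H) ((α.erase i).erase j) i j else 0 := by
      rw [cofactorSum, Finset.sum_filter, Finset.sum_filter]
      refine Finset.sum_congr rfl fun α _ => ?_
      simp only [rowCofactor, if_neg hij, Finset.mem_erase, hij.symm, ne_eq, not_false_eq_true,
        true_and]
      rw [Finset.erase_right_comm]
      split_ifs <;> rfl
    rw [hcof, sum_powersetCard_erase (fun β => if j ∈ β then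
      -pathSum H (principalDet H) (β.erase j) i j else 0), Matrix.diagonal_apply_ne _ hij,
      Finset.sum_filter, Finset.sum_filter, ← Finset.sum_add_distrib]
    refine Finset.sum_eq_zero fun α _ => ?_
    by_cases hi : i ∈ α
    · simp [hi, pathSum_eq_zero_of_mem hH hT (Finset.mem_erase.2 ⟨hij, hi⟩)]
    · by_cases hj : j ∈ α <;> simp [hi, hj]

end Coefficients

/-! ### Rank and trace -/

section Rank

variable {m n : ℕ}

lemma re_trace_mul_comm (A : Matrix (Fin m) (Fin n) ℍ) (B : Matrix (Fin n) (Fin m) ℍ) :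
    (A * B).trace.re = (B * A).trace.re := by
  have hsum : ∀ {p : ℕ} (F : Fin p → ℍ), (∑ k, F k).re = ∑ k, (F k).re := fun F =>
    map_sum (QuaternionAlgebra.reₗ _ _ _) F Finset.univ
  simp only [Matrix.trace, Matrix.diag_apply, Matrix.mul_apply, hsum]
  rw [Finset.sum_comm]
  refine Finset.sum_congr rfl fun i _ => Finset.sum_congr rfl fun j _ => ?_
  simp only [Quaternion.re_mul]
  ring

lemma re_trace_mul_eq_qrank {A : Matrix (Fin m) (Fin n) ℍ} {X : Matrix (Fin n) (Fin m) ℍ}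
    (h : A * X * A = A) : (X * A).trace.re = qrank A := by
  set W := Submodule.span ℍ (Set.range A)
  let b := Module.finBasis ℍ W
  let B : Matrix (Fin (Module.finrank ℍ W)) (Fin n) ℍ := fun k => (b k : Fin n → ℍ)
  have hmem : ∀ i, (X * A) i ∈ W := fun i => by
    have hrow : (X * A) i = ∑ k, X i k • A k := by
      ext1 j
      simp [Matrix.mul_apply]
    rw [hrow]
    exact Submodule.sum_mem _ fun k _ =>
      Submodule.smul_mem _ _ (Submodule.subset_span ⟨k, rfl⟩)
  let C : Matrix (Fin n) (Fin (Module.finrank ℍ W)) ℍ := fun i k => b.repr ⟨_, hmem i⟩ k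
  have hcomb : ∀ c : Fin (Module.finrank ℍ W) → ℍ, ((∑ k, c k • b k : W) : Fin n → ℍ) = c ᵥ* B := by
    intro c
    ext1 j
    simp [Matrix.vecMul, dotProduct, B]
  have hCB : C * B = X * A := by
    refine funext fun i => (hcomb (C i)).symm.trans ?_
    rw [b.sum_repr]
  have hfix : ∀ w ∈ W, w ᵥ* (X * A) = w := by
    intro w hw
    induction hw using Submodule.span_induction with
    | mem w hw =>
      obtain ⟨i, rfl⟩ := hw
      exact congrFun ((Matrix.mul_assoc A X A).symm.trans h) i
    | zero => exact Matrix.zero_vecMul _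
    | add x y _ _ hx hy => rw [Matrix.add_vecMul, hx, hy]
    | smul c x _ hx => rw [Matrix.smul_vecMul, hx]
  have hBC : B * C = 1 := by
    ext1 k l
    have hk : ∑ l, (B * C) k l • b l = b k := by
      refine Subtype.ext ((hcomb _).trans ?_)
      change (B * C * B) k = B k
      rw [Matrix.mul_assoc, hCB]
      exact hfix _ (b k).2
    have hrepr := congrFun (b.repr_sum_self ((B * C) k)) l
    rw [hk, b.repr_self, Finsupp.single_apply] at hrepr
    rw [← hrepr, Matrix.one_apply]
  rw [← hCB, re_trace_mul_comm, hBC, Matrix.trace_one, Fintype.card_fin, Quaternion.re_natCast]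
  rfl

end Rank

/-! ### The Moore–Penrose inverse -/

section MoorePenrose

variable {m n : ℕ} {A : Matrix (Fin m) (Fin n) ℍ} {X : Matrix (Fin n) (Fin m) ℍ}

lemma IsMP.mul_mul_conjTranspose (hX : IsMP A X) : X * (A * Aᴴ) = Aᴴ := by
  rw [← Matrix.mul_assoc, ← hX.2.2.2, ← Matrix.conjTranspose_mul, ← Matrix.mul_assoc, hX.1]

lemma IsMP.conjTranspose_mul_mul (hX : IsMP A X) : Xᴴ * (X * (A * Aᴴ)) = A * X := by
  rw [hX.mul_mul_conjTranspose, ← Matrix.conjTranspose_mul, hX.2.2.1]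

lemma IsMP.mul_eq_zero (hX : IsMP A X) {M : Matrix (Fin m) (Fin m) ℍ}
    (h : A * Aᴴ * M = 0) : X * M = 0 := by
  rw [← hX.2.1, Matrix.mul_assoc X A X, ← hX.conjTranspose_mul_mul]
  simp only [Matrix.mul_assoc] at h ⊢
  simp [h]

lemma IsMP.gram_mul_eq_zero (hX : IsMP A X) {M : Matrix (Fin m) (Fin m) ℍ}
    (h : A * Aᴴ * (A * Aᴴ * M) = 0) : A * Aᴴ * M = 0 := by
  have h' := hX.mul_eq_zero h
  rw [← Matrix.mul_assoc, hX.mul_mul_conjTranspose] at h'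
  rw [Matrix.mul_assoc, h', Matrix.mul_zero]

/-- The order of the last nonvanishing sum of principal minors of `A * Aᴴ` is the rank of `A`,
and the next cofactor sum is annihilated by the Moore–Penrose inverse. -/
lemma IsMP.minorSum_ne_zero_and (hX : IsMP A X) :
    minorSum (A * Aᴴ) (qrank A) ≠ 0 ∧ X * cofactorSum (A * Aᴴ) (qrank A + 1) = 0 := by
  set G := A * Aᴴ with hG
  have hGH : ∀ a b, star (G a b) = G b a := fun a b =>
    congrFun (congrFun (Matrix.isHermitian_mul_conjTranspose_self A) b) a
  have hrec := mul_cofactorSum_add hGH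
  set s := Nat.findGreatest (fun k => minorSum G k ≠ 0) m
  have hs_ne : minorSum G s ≠ 0 :=
    Nat.findGreatest_spec (P := fun k => minorSum G k ≠ 0) (Nat.zero_le m)
      (by rw [minorSum_zero]; exact one_ne_zero)
  have hs_lt : ∀ k, s < k → minorSum G k = 0 := fun k hk => by
    by_contra hne
    obtain hkm | hkm := le_or_gt k m
    · exact Nat.findGreatest_is_greatest hk hkm hne
    · exact hne (minorSum_of_lt G hkm)
  have hGE : ∀ d k, s < k → m < k + d → G * cofactorSum G k = 0 := by
    intro d
    induction d with
    | zero => exact fun k _ hk => by rw [cofactorSum_of_lt G (by omega), Matrix.mul_zero]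
    | succ d ih =>
      intro k hsk hk
      have h := hrec k
      rw [hs_lt k hsk, Matrix.diagonal_zero, ← eq_neg_iff_add_eq_zero] at h
      refine hX.gram_mul_eq_zero ?_
      rw [← hG, h, Matrix.mul_neg, ih (k + 1) (by omega) (by omega), neg_zero]
  have hXE : X * cofactorSum G (s + 1) = 0 :=
    hX.mul_eq_zero (hGE m (s + 1) (by omega) (by omega))
  have hE : cofactorSum G (s + 1) = (1 - A * X) *
      (Matrix.diagonal fun _ => minorSum G s : Matrix (Fin m) (Fin m) ℍ) := by
    have hPG : A * X * G = G := by rw [hG, ← Matrix.mul_assoc, hX.1]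
    rw [← hrec s, Matrix.sub_mul, Matrix.one_mul, Matrix.mul_add, ← Matrix.mul_assoc, hPG,
      Matrix.mul_assoc A X, hXE, Matrix.mul_zero]
    abel
  have htr := trace_cofactorSum G s
  have htr' : (cofactorSum G (s + 1)).trace = (1 - A * X).trace * minorSum G s := by
    rw [hE]
    simp only [Matrix.trace, Matrix.diag_apply, Matrix.mul_diagonal, Finset.sum_mul]
  have hrank : s = qrank A := by
    have htrace : (1 - A * X).trace = (m : ℍ) - s :=
      mul_right_cancel₀ hs_ne (htr'.symm.trans htr)
    have h := congrArg QuaternionAlgebra.re htrace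
    rw [Matrix.trace_sub, Matrix.trace_one, Fintype.card_fin, Quaternion.re_sub,
      Quaternion.re_sub, re_trace_mul_comm, re_trace_mul_eq_qrank hX.1, sub_right_inj,
      Quaternion.re_natCast] at h
    exact_mod_cast h.symm
  rw [← hrank]
  exact ⟨hs_ne, hXE⟩

lemma IsMP.conjTranspose_mul_cofactorSum (hX : IsMP A X) :
    Aᴴ * cofactorSum (A * Aᴴ) (qrank A) =
      X * (Matrix.diagonal fun _ => minorSum (A * Aᴴ) (qrank A) :
        Matrix (Fin m) (Fin m) ℍ) := by
  have hGH : ∀ a b, star ((A * Aᴴ) a b) = (A * Aᴴ) b a := fun a b =>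
    congrFun (congrFun (Matrix.isHermitian_mul_conjTranspose_self A) b) a
  rw [← mul_cofactorSum_add hGH, Matrix.mul_add, hX.minorSum_ne_zero_and.2, add_zero,
    ← Matrix.mul_assoc, hX.mul_mul_conjTranspose]

end MoorePenrose

/-- Determinantal representation of the Moore–Penrose inverse via
row determinants. -/
theorem moorePenrose_rdet_representation {m n : ℕ} (r : ℕ)
    (A : Matrix (Fin m) (Fin n) ℍ) (hr : qrank A = r)
    (X : Matrix (Fin n) (Fin m) ℍ) (hX : IsMP A X) (i : Fin n) (j : Fin m) :
    X i j =
      (∑ α ∈ (Finset.powersetCard r (Finset.univ : Finset (Fin m))).filter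
          (fun α => j ∈ α),
        minorRdet ((A * Aᴴ).updateRow j (fun t => Aᴴ i t)) α j) /
      (∑ α ∈ Finset.powersetCard r (Finset.univ : Finset (Fin m)),
        minorDet (A * Aᴴ) α) := by
  subst hr
  have hden : ∑ α ∈ Finset.powersetCard (qrank A) (Finset.univ : Finset (Fin m)),
      minorDet (A * Aᴴ) α = minorSum (A * Aᴴ) (qrank A) :=
    Finset.sum_congr rfl fun α _ => minorDet_eq_principalDet _ α
  rw [hden, sum_minorRdet_updateRow, eq_div_iff hX.minorSum_ne_zero_and.1]
  have h := congrFun (congrFun hX.conjTranspose_mul_cofactorSum i) j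
  rw [Matrix.mul_diagonal, Matrix.mul_apply] at h
  exact h.symm
end
end

section
/- Let A ∈ ℍ^{m×n} and W ∈ ℍ^{n×m} with k = max{Ind(AW), Ind(WA)}. Then W A W A_{d,W} ∈ ℍ^{n×n} is the projector onto the right column space R_r((WA)^k) along the right null space N_r((WA)^k): it is idempotent, it fixes every column vector in R_r((WA)^k), and it annihilates every column vector in N_r((WA)^k). Dually, A_{d,W} W A W ∈ ℍ^{m×m} is the projector (acting on row vectors by right multiplication) onto the left row space R_l((AW)^k) along the left null space N_l((AW)^k): it is idempotent, every row vector in R_l((AW)^k) is fixed under right multiplication by it, and every row vector in N_l((AW)^k) is annihilated by right multiplication by it. -/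
open Matrix
open scoped Classical

noncomputable section

local notation "ℍ" => Quaternion ℝ

/-- A matrix whose rows lie in the row space of `N` is a left multiple of `N`. -/
theorem exists_eq_mul_of_rows_mem_span {l m n : ℕ} {M : Matrix (Fin l) (Fin n) ℍ}
    {N : Matrix (Fin m) (Fin n) ℍ} (h : ∀ i, M i ∈ Submodule.span ℍ (Set.range N)) :
    ∃ C : Matrix (Fin l) (Fin m) ℍ, M = C * N := by
  choose c hc using fun i => (Submodule.mem_span_range_iff_exists_fun ℍ).1 (h i)
  refine ⟨Matrix.of c, ?_⟩
  ext1 i j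
  rw [← hc i]
  simp [Matrix.mul_apply, Finset.sum_apply]

theorem span_rows_mul_le {l m n : ℕ} (C : Matrix (Fin l) (Fin m) ℍ)
    (N : Matrix (Fin m) (Fin n) ℍ) :
    Submodule.span ℍ (Set.range (C * N)) ≤ Submodule.span ℍ (Set.range N) := by
  rw [Submodule.span_le]
  rintro _ ⟨i, rfl⟩
  refine (Submodule.mem_span_range_iff_exists_fun ℍ).2 ⟨C i, ?_⟩
  ext1 j
  simp [Matrix.mul_apply, Finset.sum_apply]

theorem qrank_mul_le_right {l m n : ℕ} (C : Matrix (Fin l) (Fin m) ℍ)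
    (N : Matrix (Fin m) (Fin n) ℍ) : qrank (C * N) ≤ qrank N :=
  Submodule.finrank_mono (span_rows_mul_le C N)

theorem exists_eq_mul_of_qrank_mul_eq {l m n : ℕ} {D : Matrix (Fin l) (Fin m) ℍ}
    {N : Matrix (Fin m) (Fin n) ℍ} (h : qrank (D * N) = qrank N) :
    ∃ C : Matrix (Fin m) (Fin l) ℍ, N = C * (D * N) := by
  apply exists_eq_mul_of_rows_mem_span
  intro i
  rw [Submodule.eq_of_le_of_finrank_eq (span_rows_mul_le D N) h]
  exact Submodule.subset_span ⟨i, rfl⟩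

theorem qrank_pow_qindex_succ {n : ℕ} (B : Matrix (Fin n) (Fin n) ℍ) :
    qrank (B ^ (qindex B + 1)) = qrank (B ^ qindex B) := by
  have hanti : Antitone fun i => qrank (B ^ i) :=
    antitone_nat_of_succ_le fun i => by
      rw [pow_succ']
      exact qrank_mul_le_right _ _
  have hne : {i | qrank (B ^ (i + 1)) = qrank (B ^ i)}.Nonempty := by
    obtain ⟨N, hN⟩ := WellFoundedLT.antitone_chain_condition hanti
    exact ⟨N, (hN (N + 1) N.le_succ).symm⟩
  exact Nat.sInf_mem hne

theorem exists_pow_eq_mul_pow_succ {n k : ℕ} {B : Matrix (Fin n) (Fin n) ℍ}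
    (hk : qindex B ≤ k) : ∃ C : Matrix (Fin n) (Fin n) ℍ, B ^ k = C * B ^ (k + 1) := by
  have h := qrank_pow_qindex_succ B
  rw [pow_succ'] at h
  obtain ⟨C, hC⟩ := exists_eq_mul_of_qrank_mul_eq h
  refine ⟨C, ?_⟩
  obtain ⟨j, rfl⟩ := Nat.exists_eq_add_of_le hk
  calc B ^ (qindex B + j) = B ^ qindex B * B ^ j := pow_add _ _ _
    _ = C * (B * B ^ qindex B) * B ^ j := by rw [← hC]
    _ = C * B ^ (qindex B + j + 1) := by
      rw [← pow_succ', mul_assoc, ← pow_add, add_right_comm]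

theorem mul_pow_mul_comm_rect {m n : ℕ} (A : Matrix (Fin m) (Fin n) ℍ)
    (W : Matrix (Fin n) (Fin m) ℍ) (i : ℕ) : (W * A) ^ i * W = W * (A * W) ^ i := by
  induction i with
  | zero => simp
  | succ i ih =>
    rw [pow_succ', pow_succ', Matrix.mul_assoc, ih]
    simp only [Matrix.mul_assoc]

/-- The identity `b ^ (k + 1) * y = b ^ k`, known with `k + 1` in place of `k`,
descends to `k` if `b ^ k` is a left multiple of `b ^ (k + 1)`. -/
theorem pow_succ_mul_eq_of_left_multiple {M : Type*} [Monoid M] {b y c : M} {k : ℕ}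
    (h : b ^ (k + 2) * y = b ^ (k + 1)) (hc : b ^ k = c * b ^ (k + 1)) :
    b ^ (k + 1) * y = b ^ k :=
  calc b ^ (k + 1) * y = c * (b ^ (k + 2) * y) := by
        rw [pow_succ b k, hc, mul_assoc c, ← pow_succ, mul_assoc]
    _ = b ^ k := by rw [h, hc]

/-- An outer inverse `y` of `b` makes `b * y` idempotent. -/
theorem isIdempotentElem_mul_of_outer {M : Type*} [Monoid M] {b y : M}
    (hy : y * b * y = y) : IsIdempotentElem (b * y) := by
  rw [IsIdempotentElem, mul_assoc, ← mul_assoc y, hy]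

theorem mul_eq_pow_mul_pow_of_outer {M : Type*} [Monoid M] {b y : M}
    (hy : y * b * y = y) (hc : Commute b y) {k : ℕ} (hk : k ≠ 0) :
    b * y = b ^ k * y ^ k := by
  rw [← hc.mul_pow, (isIdempotentElem_mul_of_outer hy).pow_eq hk]

/-- `WAW A_{d,W}` is the projector onto `R_r((WA)^k)` along
`N_r((WA)^k)`, and `A_{d,W} WAW` is the projector (acting on row vectors on the
right) onto `R_l((AW)^k)` along `N_l((AW)^k)`. -/
theorem wdrazin_projectors {m n : ℕ} (k : ℕ) (A : Matrix (Fin m) (Fin n) ℍ)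
    (W : Matrix (Fin n) (Fin m) ℍ)
    (hk : k = max (qindex (A * W)) (qindex (W * A)))
    (X : Matrix (Fin m) (Fin n) ℍ) (hX : IsWDrazin A W X) :
    ((W * A * W * X) * (W * A * W * X) = W * A * W * X ∧
      (∀ y : Fin n → ℍ, (∃ z : Fin n → ℍ, y = ((W * A) ^ k).mulVec z) →
        (W * A * W * X).mulVec y = y) ∧
      (∀ y : Fin n → ℍ, ((W * A) ^ k).mulVec y = 0 →
        (W * A * W * X).mulVec y = 0)) ∧
    ((X * W * A * W) * (X * W * A * W) = X * W * A * W ∧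
      (∀ y : Fin m → ℍ, (∃ z : Fin m → ℍ, y = Matrix.vecMul z ((A * W) ^ k)) →
        Matrix.vecMul y (X * W * A * W) = y) ∧
      (∀ y : Fin m → ℍ, Matrix.vecMul y ((A * W) ^ k) = 0 →
        Matrix.vecMul y (X * W * A * W) = 0)) := by
  obtain ⟨h1, h2, h3⟩ := hX
  rw [← hk] at h1
  set b := W * A with hb
  set a := A * W with ha
  set y := W * X with hy
  set z := X * W with hz
  have hYY : y * b * y = y := by
    calc y * b * y = W * (X * W * A * W * X) := by simp only [hy, hb, Matrix.mul_assoc]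
      _ = y := by rw [h2]
  have hZZ : z * a * z = z := by
    calc z * a * z = X * W * A * W * X * W := by simp only [hz, ha, Matrix.mul_assoc]
      _ = z := by rw [h2]
  have hby : Commute b y := by
    calc b * y = W * (a * X) := by simp only [hy, hb, ha, Matrix.mul_assoc]
      _ = y * b := by rw [h3]; simp only [hy, hz, hb, Matrix.mul_assoc]
  have haz : Commute a z := by
    calc a * z = a * X * W := by simp only [hz, Matrix.mul_assoc]
      _ = z * a := by rw [h3]; simp only [ha, Matrix.mul_assoc]
  have hpa : a ^ (k + 1) * z = a ^ k := by rw [hz, ← Matrix.mul_assoc, h1]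
  have hpb : b ^ (k + 1) * y = b ^ k := by
    obtain ⟨C, hC⟩ := exists_pow_eq_mul_pow_succ (B := b) (k := k) (hk ▸ le_max_right _ _)
    refine pow_succ_mul_eq_of_left_multiple ?_ hC
    calc b ^ (k + 2) * y = b ^ (k + 1) * y * b := by
          rw [pow_succ, mul_assoc, hby.eq, mul_assoc]
      _ = b ^ (k + 1) * W * z * A := by
          simp only [hy, hz, hb, Matrix.mul_assoc]
      _ = W * (a ^ (k + 1) * z) * A := by
          rw [hb, mul_pow_mul_comm_rect, Matrix.mul_assoc W]
      _ = b ^ (k + 1) := by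
          rw [hpa, ha, ← mul_pow_mul_comm_rect, Matrix.mul_assoc, ← hb, pow_succ]
  have e1 : b * W * X = b * y := Matrix.mul_assoc _ _ _
  have e2 : z * A * W = a * z := by rw [haz.eq]; exact Matrix.mul_assoc _ _ _
  rw [e1, e2]
  refine ⟨⟨isIdempotentElem_mul_of_outer hYY, ?_, ?_⟩,
    isIdempotentElem_mul_of_outer hZZ, ?_, ?_⟩
  · rintro _ ⟨v, rfl⟩
    rw [Matrix.mulVec_mulVec, hby.eq, mul_assoc, ← pow_succ', ← (hby.pow_left _).eq, hpb]
  · intro v hv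
    rw [mul_eq_pow_mul_pow_of_outer hYY hby k.succ_ne_zero, (hby.pow_pow _ _).eq, pow_succ' b,
      ← mul_assoc, ← Matrix.mulVec_mulVec, hv, Matrix.mulVec_zero]
  · rintro _ ⟨v, rfl⟩
    rw [Matrix.vecMul_vecMul, ← mul_assoc, ← pow_succ, hpa]
  · intro v hv
    rw [mul_eq_pow_mul_pow_of_outer hZZ haz k.succ_ne_zero, pow_succ a, mul_assoc,
      ← Matrix.vecMul_vecMul, hv, Matrix.zero_vecMul]
end
end
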